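/- arXiv:2407.04857 — 2 statements merged into one kernel-verified Lean document; each statement's English description precedes it below -/
import Mathlib

section
/- For every T ∈ ℕ and every length-T dynamic two-sided economy E^T, the set of CVR-dynamically stable matchings D̂S_T(E^T) is nonempty. -/
/-!
A framework for two-sided, one-to-one, irreversible dynamic matching markets
with conjectures, following Doval's "A framework for (dynamic) stability".

Periods are indexed `0, …, T-1` (the paper's periods `1, …, T`).
-/

namespace DynMatch

open Classical

noncomputable section

/-- A length-`T` two-sided dynamic economy: the arrivals on each side in each period. -/
structure Economy (A B : Type) where
  T : ℕ
  arrA : ℕ → Finset A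
  arrB : ℕ → Finset B

/-- Validity of an economy: positive length, pairwise disjoint arrivals, and
no arrivals outside the horizon. -/
def Economy.Valid {A B : Type} (E : Economy A B) : Prop :=
  0 < E.T ∧
  (∀ s t, s ≠ t → Disjoint (E.arrA s) (E.arrA t)) ∧
  (∀ s t, s ≠ t → Disjoint (E.arrB s) (E.arrB t)) ∧
  (∀ s, E.T ≤ s → E.arrA s = ∅) ∧ (∀ s, E.T ≤ s → E.arrB s = ∅)

/-- A raw dynamic matching: in every period, a partial pairing between the two sides
(`none` means unmatched, i.e. matched to oneself). -/
structure PreMatching (A B : Type) where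
  mA : ℕ → A → Option B
  mB : ℕ → B → Option A

variable {A B : Type} [DecidableEq A] [DecidableEq B]

/-- Side-`A` agents having arrived up to (and including) period `t`. -/
def arrAUpTo (E : Economy A B) (t : ℕ) : Finset A := (Finset.range (t+1)).biUnion E.arrA

/-- Side-`B` agents having arrived up to (and including) period `t`. -/
def arrBUpTo (E : Economy A B) (t : ℕ) : Finset B := (Finset.range (t+1)).biUnion E.arrB

/-- `m` is an irreversible dynamic matching for the economy `E`: in every period it is
an involutive pairing between arrived agents of the two sides, and once matched a
pair stays matched. -/
def IsMatching (E : Economy A B) (m : PreMatching A B) : Prop :=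
  (∀ t a b, t < E.T → (m.mA t a = some b ↔ m.mB t b = some a)) ∧
  (∀ t a, t < E.T → m.mA t a ≠ none → a ∈ arrAUpTo E t) ∧
  (∀ t a b, t < E.T → m.mA t a = some b → b ∈ arrBUpTo E t) ∧
  (∀ t s a, t ≤ s → s < E.T → m.mA t a ≠ none → m.mA s a = m.mA t a) ∧
  (∀ t s b, t ≤ s → s < E.T → m.mB t b ≠ none → m.mB s b = m.mB t b)

/-- The everywhere-unmatched prematching. -/
def emptyM : PreMatching A B := ⟨fun _ _ => none, fun _ _ => none⟩

/-- An agent of the economy: a side-`A` or a side-`B` agent. -/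
abbrev Agent (A B : Type) := A ⊕ B

/-- `𝒜_t(m^{t-1})`: side-`A` agents available to match in period `t` given history `m`. -/
def availA (E : Economy A B) (m : PreMatching A B) (t : ℕ) : Finset A :=
  (arrAUpTo E t).filter fun a => ∀ s, s < t → m.mA s a = none

/-- `ℬ_t(m^{t-1})`: side-`B` agents available to match in period `t` given history `m`. -/
def availB (E : Economy A B) (m : PreMatching A B) (t : ℕ) : Finset B :=
  (arrBUpTo E t).filter fun b => ∀ s, s < t → m.mB s b = none

/-- `k ∈ 𝒜_t(m^{t-1}) ∪ ℬ_t(m^{t-1})`. -/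
def isAvail (E : Economy A B) (m : PreMatching A B) (t : ℕ) : Agent A B → Prop
  | Sum.inl a => a ∈ availA E m t
  | Sum.inr b => b ∈ availB E m t

/-- `k ∈ A_1 ∪ B_1`: `k` is a first-period arrival. -/
def inPeriodOne (E : Economy A B) : Agent A B → Prop
  | Sum.inl a => a ∈ E.arrA 0
  | Sum.inr b => b ∈ E.arrB 0

/-- `m_t(k) = k`: agent `k` is unmatched in period `t` under `m`. -/
def unmatchedAt (m : PreMatching A B) (t : ℕ) : Agent A B → Prop
  | Sum.inl a => m.mA t a = none
  | Sum.inr b => m.mB t b = none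

/-- `m` and `m'` agree in all periods `s < t` (i.e. they share the history `m^{t-1}`). -/
def agreeUpTo (m m' : PreMatching A B) (t : ℕ) : Prop :=
  ∀ s, s < t → (∀ a, m.mA s a = m'.mA s a) ∧ (∀ b, m.mB s b = m'.mB s b)

/-- Agent `k` is unmatched through period `t` (all periods `s ≤ t`) under `m`. -/
def unmatchedThrough (m : PreMatching A B) (t : ℕ) : Agent A B → Prop
  | Sum.inl a => ∀ s, s ≤ t → m.mA s a = none
  | Sum.inr b => ∀ s, s ≤ t → m.mB s b = none

/-- `M_T(m^{t-1})`: matchings of `E` agreeing with `m` through period `t-1`. -/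
def MSetH (E : Economy A B) (m : PreMatching A B) (t : ℕ) : Set (PreMatching A B) :=
  {m' | IsMatching E m' ∧ agreeUpTo m m' t}

/-- `M_T(m^{t-1}, k)`: matchings of `E` agreeing with `m` through period `t-1` and
leaving `k` unmatched through period `t`. -/
def MSet (E : Economy A B) (m : PreMatching A B) (t : ℕ) (k : Agent A B) :
    Set (PreMatching A B) :=
  {m' | IsMatching E m' ∧ agreeUpTo m m' t ∧ unmatchedThrough m' t k}

/-- Preferences: Bernoulli utilities on both sides and discount factors.
(The payoff of remaining single is normalized to `0`.) -/
structure Pref (A B : Type) where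
  u : A → B → ℝ
  v : A → B → ℝ
  dA : A → ℝ
  dB : B → ℝ

/-- Discount factors lie in `[0,1]`. -/
def Pref.Valid (P : Pref A B) : Prop :=
  (∀ a, 0 ≤ P.dA a ∧ P.dA a ≤ 1) ∧ (∀ b, 0 ≤ P.dB b ∧ P.dB b ≤ 1)

/-- `t_m(a)`: the first period `s ≥ t` at which `a` is matched under `m` (`T` if never). -/
def matchTimeA (E : Economy A B) (m : PreMatching A B) (t : ℕ) (a : A) : ℕ :=
  min (sInf {s | t ≤ s ∧ m.mA s a ≠ none}) E.T

/-- `t_m(b)`: the first period `s ≥ t` at which `b` is matched under `m` (`T` if never). -/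
def matchTimeB (E : Economy A B) (m : PreMatching A B) (t : ℕ) (b : B) : ℕ :=
  min (sInf {s | t ≤ s ∧ m.mB s b ≠ none}) E.T

/-- `U_t(a,m) = δ_a^{t_m(a)-t}·u(a, m_T(a))` (and `0` if `a` ends up unmatched). -/
def Upay (P : Pref A B) (E : Economy A B) (m : PreMatching A B) (t : ℕ) (a : A) : ℝ :=
  match m.mA (E.T - 1) a with
  | none => 0
  | some b => P.dA a ^ (matchTimeA E m t a - t) * P.u a b

/-- `V_t(b,m) = δ_b^{t_m(b)-t}·v(m_T(b), b)` (and `0` if `b` ends up unmatched). -/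
def Vpay (P : Pref A B) (E : Economy A B) (m : PreMatching A B) (t : ℕ) (b : B) : ℝ :=
  match m.mB (E.T - 1) b with
  | none => 0
  | some a => P.dB b ^ (matchTimeB E m t b - t) * P.v a b

/-- A family of conjectures `Φ`: for every period `t`, history `m^{t-1}` and agent `k`,
a set `φ_t(m^{t-1},k)` of matchings `k` considers possible upon remaining unmatched. -/
abbrev ConjFam (A B : Type) := ℕ → PreMatching A B → Agent A B → Set (PreMatching A B)

/-- Validity of a family of conjectures for `E`: conjectures are (nonempty) subsets of
`M_T(m^{t-1},k)` and depend on the matching only through the history `m^{t-1}`. -/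
def ConjFam.Valid (E : Economy A B) (φ : ConjFam A B) : Prop :=
  (∀ t m k, φ t m k ⊆ MSet E m t k) ∧
  (∀ t m m' k, agreeUpTo m m' t → φ t m k = φ t m' k) ∧
  (∀ t m k, t < E.T → IsMatching E m → isAvail E m t k → (φ t m k).Nonempty)

/-- `m` is a `Φ`-solution for `E` (Definition 3): in every period, every available agent
weakly prefers `m` to some conjectured matching, and no available pair blocks. -/
def IsSolution (P : Pref A B) (E : Economy A B) (φ : ConjFam A B)
    (m : PreMatching A B) : Prop :=
  IsMatching E m ∧
  ∀ t, t < E.T →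
    ((∀ a ∈ availA E m t, ∃ m' ∈ φ t m (Sum.inl a), Upay P E m' t a ≤ Upay P E m t a) ∧
     (∀ b ∈ availB E m t, ∃ m' ∈ φ t m (Sum.inr b), Vpay P E m' t b ≤ Vpay P E m t b) ∧
     (∀ a ∈ availA E m t, ∀ b ∈ availB E m t,
        ¬(P.u a b > Upay P E m t a ∧ P.v a b > Vpay P E m t b)))

/-- `Σ^Φ_T(E)`: the set of `Φ`-solutions of `E`. -/
def SolSet (P : Pref A B) (E : Economy A B) (φ : ConjFam A B) : Set (PreMatching A B) :=
  {m | IsSolution P E φ m}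

/-- The static (Gale–Shapley) notion of stability, for length-1 economies:
individual rationality plus absence of blocking pairs. -/
def Stable1 (P : Pref A B) (E : Economy A B) (m : PreMatching A B) : Prop :=
  IsMatching E m ∧
  (∀ a b, m.mA (E.T - 1) a = some b → 0 ≤ P.u a b) ∧
  (∀ b a, m.mB (E.T - 1) b = some a → 0 ≤ P.v a b) ∧
  (∀ a ∈ E.arrA 0, ∀ b ∈ E.arrB 0,
     ¬(P.u a b > Upay P E m 0 a ∧ P.v a b > Vpay P E m 0 b))

/-- The worst (minimal) period-`t` payoff of `a` over the set `C (inl a)` of matchings. -/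
def wA (P : Pref A B) (E : Economy A B) (t : ℕ)
    (C : Agent A B → Set (PreMatching A B)) (a : A) : ℝ :=
  sInf ((fun m' => Upay P E m' t a) '' C (Sum.inl a))

/-- The worst (minimal) period-`t` payoff of `b` over the set `C (inr b)` of matchings. -/
def wB (P : Pref A B) (E : Economy A B) (t : ℕ)
    (C : Agent A B → Set (PreMatching A B)) (b : B) : ℝ :=
  sInf ((fun m' => Vpay P E m' t b) '' C (Sum.inr b))

/-- Utility of side-`A` agent `a` in the induced one-period economy with outside
option value `W a` (truncated preferences). -/
def indU (P : Pref A B) (W : A → ℝ) (a : A) : Option B → ℝ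
  | none => W a
  | some b => P.u a b

/-- Utility of side-`B` agent `b` in the induced one-period economy with outside
option value `W b` (truncated preferences). -/
def indV (P : Pref A B) (W : B → ℝ) (b : B) : Option A → ℝ
  | none => W b
  | some a => P.v a b

/-- The period-`t` component of `mbar` is a stable matching of the one-period economy
`E_{t,φ}(m^{t-1})` induced by the conjecture profile `C` (Definition 6): matching among
the available agents, individually rational w.r.t. the worst-conjecture thresholds,
and without blocking pairs in the truncated preferences. -/
def StableInduced (P : Pref A B) (E : Economy A B) (m : PreMatching A B) (t : ℕ)
    (C : Agent A B → Set (PreMatching A B)) (mbar : PreMatching A B) : Prop :=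
  (∀ a ∈ availA E m t, ∀ b, mbar.mA t a = some b → b ∈ availB E m t ∧ mbar.mB t b = some a) ∧
  (∀ b ∈ availB E m t, ∀ a, mbar.mB t b = some a → a ∈ availA E m t ∧ mbar.mA t a = some b) ∧
  (∀ a ∈ availA E m t, ∀ b, mbar.mA t a = some b → wA P E t C a ≤ P.u a b) ∧
  (∀ b ∈ availB E m t, ∀ a, mbar.mB t b = some a → wB P E t C b ≤ P.v a b) ∧
  (∀ a ∈ availA E m t, ∀ b ∈ availB E m t,
     ¬(P.u a b > indU P (wA P E t C) a (mbar.mA t a) ∧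
       P.v a b > indV P (wB P E t C) b (mbar.mB t b)))

/-- `mbar_t` is stable among those who match in period `t` relative to the conjecture
profile `C` (Definition 7): every available agent matched in period `t` weakly prefers
its partner to its worst conjectured matching, and no pair of agents both matched in
period `t` blocks. -/
def StableAmongMatched (P : Pref A B) (E : Economy A B) (m : PreMatching A B) (t : ℕ)
    (C : Agent A B → Set (PreMatching A B)) (mbar : PreMatching A B) : Prop :=
  (∀ a ∈ availA E m t, ∀ b, mbar.mA t a = some b → wA P E t C a ≤ P.u a b) ∧
  (∀ b ∈ availB E m t, ∀ a, mbar.mB t b = some a → wB P E t C b ≤ P.v a b) ∧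
  (∀ a ∈ availA E m t, ∀ b ∈ availB E m t, ∀ b' a',
     mbar.mA t a = some b' → mbar.mB t b = some a' →
     ¬(P.u a b > P.u a b' ∧ P.v a b > P.v a' b))

/-- `E_t^T(m^{t-1})`: the continuation economy starting at period `t` given history `m`:
its first-period arrivals are the agents available at `t`, later arrivals are unchanged. -/
def contEconomy (E : Economy A B) (m : PreMatching A B) (t : ℕ) : Economy A B where
  T := E.T - t
  arrA := fun s => if s = 0 then availA E m t else E.arrA (t + s)
  arrB := fun s => if s = 0 then availB E m t else E.arrB (t + s)

/-- The restriction of `m` to the continuation economy starting in period `t`: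
time is shifted by `t` and agents matched strictly before `t` are dropped. -/
def restrictM (m : PreMatching A B) (t : ℕ) : PreMatching A B where
  mA := fun s a => if ∀ s', s' < t → m.mA s' a = none then m.mA (t + s) a else none
  mB := fun s b => if ∀ s', s' < t → m.mB s' b = none then m.mB (t + s) b else none

/-- The matching of the original economy corresponding to history `m` through period
`t-1` followed by the continuation matching `m'` (indexed from `0`) of the
continuation economy. -/
def splice (m m' : PreMatching A B) (t : ℕ) : PreMatching A B where
  mA := fun s a => if s < t then m.mA s a
    else if ∀ s', s' < t → m.mA s' a = none then m'.mA (s - t) a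
    else m.mA (t - 1) a
  mB := fun s b => if s < t then m.mB s b
    else if ∀ s', s' < t → m.mB s' b = none then m'.mB (s - t) b
    else m.mB (t - 1) b

/-- The family of conjectures that the family `φ` of the original economy induces on the
continuation economy `E_t^T(m^{t-1})`: at a continuation history, it is the (restriction
of the) original conjectures at the corresponding original history. -/
def contConj (E : Economy A B) (φ : ConjFam A B) (m : PreMatching A B) (t : ℕ) :
    ConjFam A B :=
  fun s mbar k => (fun m' => restrictM m' t) '' φ (t + s) (splice m mbar t) k

/-- The conjectures of eq. (2): the agent only rules out continuation matchings that do
not conform with the solution concept `S` from tomorrow onward. -/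
def starConj (S : Economy A B → Set (PreMatching A B)) (E : Economy A B) : ConjFam A B :=
  fun t m k =>
    {m' | m' ∈ MSet E m t k ∧ restrictM m' (t+1) ∈ S (contEconomy E m' (t+1))}

/-- `S` is the solution correspondence `Σ*` recursively generated by the conjectures of
eq. (2): stability for one-period economies, `Φ*`-solutions for longer economies
(empty continuations impose no restriction). -/
def IsStarFamily (P : Pref A B) (S : Economy A B → Set (PreMatching A B)) : Prop :=
  (∀ E : Economy A B, E.T = 0 → S E = Set.univ) ∧
  (∀ E : Economy A B, E.T = 1 → S E = {m | Stable1 P E m}) ∧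
  (∀ E : Economy A B, 2 ≤ E.T → S E = SolSet P E (starConj S E))

/-- The decreasing recursion defining the CVR conjectures at period `t`, history `m`,
relative to the continuation solution correspondence `DS`. -/
def cvrIter (P : Pref A B) (E : Economy A B)
    (DS : Economy A B → Set (PreMatching A B)) (t : ℕ) (m : PreMatching A B) :
    ℕ → Agent A B → Set (PreMatching A B)
  | 0 => fun k => MSet E m t k
  | n+1 => fun k =>
      {mbar | mbar ∈ MSet E m t k ∧
        StableAmongMatched P E m t (cvrIter P E DS t m n) mbar ∧
        restrictM mbar (t+1) ∈ DS (contEconomy E mbar (t+1))}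

/-- The CVR conjectures `φ_{D̂S,t}(m^{t-1},·)`: the limit (intersection) of the
decreasing recursion `cvrIter`. -/
def cvrConj (P : Pref A B) (DS : Economy A B → Set (PreMatching A B))
    (E : Economy A B) : ConjFam A B :=
  fun t m k => ⋂ n, cvrIter P E DS t m n k

/-- `DS` is the CVR-dynamic-stability correspondence `D̂S`: stable matchings for
one-period economies, `Φ_{D̂S}`-solutions for longer economies. -/
def IsCVRFamily (P : Pref A B) (DS : Economy A B → Set (PreMatching A B)) : Prop :=
  (∀ E : Economy A B, E.T = 0 → DS E = Set.univ) ∧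
  (∀ E : Economy A B, E.T = 1 → DS E = {m | Stable1 P E m}) ∧
  (∀ E : Economy A B, 2 ≤ E.T → DS E = SolSet P E (cvrConj P DS E))

/-- The dynamic-stability conjectures of Doval (2022): the period-`t` matching is stable
among those who match relative to individually rational continuation values, and the
continuation is dynamically stable. -/
def dsConj (P : Pref A B) (DSol : Economy A B → Set (PreMatching A B))
    (E : Economy A B) : ConjFam A B :=
  fun t m k =>
    {mbar | mbar ∈ MSet E m t k ∧
      (∀ a ∈ availA E m t, ∀ b, mbar.mA t a = some b → 0 ≤ P.u a b) ∧
      (∀ b ∈ availB E m t, ∀ a, mbar.mB t b = some a → 0 ≤ P.v a b) ∧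
      (∀ a ∈ availA E m t, ∀ b ∈ availB E m t, ∀ b' a',
         mbar.mA t a = some b' → mbar.mB t b = some a' →
         ¬(P.u a b > P.u a b' ∧ P.v a b > P.v a' b)) ∧
      restrictM mbar (t+1) ∈ DSol (contEconomy E mbar (t+1))}

/-- `DSol` is the dynamic-stability correspondence `DS` of Doval (2022). -/
def IsDSFamily (P : Pref A B) (DSol : Economy A B → Set (PreMatching A B)) : Prop :=
  (∀ E : Economy A B, E.T = 0 → DSol E = Set.univ) ∧
  (∀ E : Economy A B, E.T = 1 → DSol E = {m | Stable1 P E m}) ∧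
  (∀ E : Economy A B, 2 ≤ E.T → DSol E = SolSet P E (dsConj P DSol E))

/-- `E_{\k}`: the economy identical to `E` except that agent `k`'s arrival is delayed
by one period (from period `0` to period `1`). -/
def delayEconomy (E : Economy A B) : Agent A B → Economy A B
  | Sum.inl a =>
      { T := E.T
        arrA := fun s => if s = 0 then E.arrA 0 \ {a}
                 else if s = 1 then insert a (E.arrA 1) else E.arrA s
        arrB := E.arrB }
  | Sum.inr b =>
      { T := E.T
        arrA := E.arrA
        arrB := fun s => if s = 0 then E.arrB 0 \ {b}
                 else if s = 1 then insert b (E.arrB 1) else E.arrB s }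

/-- The candidate set `M*(m^{t-1}, C, Scont)`: matchings whose period-`t` matching is
stable in the one-period economy induced by the continuation-value sets `C`, and whose
continuation lies in `Scont` of the induced continuation economy. -/
def candT (P : Pref A B) (Scont : Economy A B → Set (PreMatching A B))
    (E : Economy A B) (t : ℕ) (m : PreMatching A B)
    (C : Agent A B → Set (PreMatching A B)) : Set (PreMatching A B) :=
  {mbar | mbar ∈ MSetH E m t ∧ StableInduced P E m t C mbar ∧
    restrictM mbar (t+1) ∈ Scont (contEconomy E mbar (t+1))}

/-- The increasing recursion `F_n` defining the sophisticated-dynamic-stability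
conjectures at period `t`, history `m`, relative to the correspondence `SDS` on
strictly shorter problems. -/
def sdsF (P : Pref A B) (SDS : Economy A B → Set (PreMatching A B))
    (E : Economy A B) (t : ℕ) (m : PreMatching A B) :
    ℕ → Agent A B → Set (PreMatching A B)
  | 0 => fun k =>
      {mbar | mbar ∈ MSet E m t k ∧
        restrictM mbar t ∈ SDS (delayEconomy (contEconomy E m t) k)}
  | n+1 => fun k => sdsF P SDS E t m n k ∪
      {mbar | mbar ∈ candT P SDS E t m (sdsF P SDS E t m n) ∧ unmatchedAt mbar t k}

/-- The SDS conjectures `φ_{SDS,t}`: the limit (union) of the increasing recursion `F_n`. -/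
def sdsConj (P : Pref A B) (SDS : Economy A B → Set (PreMatching A B))
    (E : Economy A B) : ConjFam A B :=
  fun t m k => ⋃ n, sdsF P SDS E t m n k

/-- `SDS` is the sophisticated-dynamic-stability correspondence. -/
def IsSDSFamily (P : Pref A B) (SDS : Economy A B → Set (PreMatching A B)) : Prop :=
  (∀ E : Economy A B, E.T = 0 → SDS E = Set.univ) ∧
  (∀ E : Economy A B, E.T = 1 → SDS E = {m | Stable1 P E m}) ∧
  (∀ E : Economy A B, 2 ≤ E.T → SDS E = SolSet P E (sdsConj P SDS E))

/-- The rational-expectations conjectures: `k` conjectures exactly the `RE` solutions of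
the continuation economy in which `k`'s arrival is delayed by one period. -/
def reConj (RE : Economy A B → Set (PreMatching A B)) (E : Economy A B) : ConjFam A B :=
  fun t m k =>
    {mbar | mbar ∈ MSet E m t k ∧
      restrictM mbar t ∈ RE (delayEconomy (contEconomy E m t) k)}

/-- `RE` is the rational-expectations solution correspondence. -/
def IsREFamily (P : Pref A B) (RE : Economy A B → Set (PreMatching A B)) : Prop :=
  (∀ E : Economy A B, E.T = 1 → RE E = {m | Stable1 P E m}) ∧
  (∀ E : Economy A B, 2 ≤ E.T → RE E = SolSet P E (reConj RE E))

/-- In a finite two-sided market with outside options `wX`, `wY` and possibly indifferent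
agents there is an individually rational matching, given by `f : Y → Option X`, without
blocking pairs. -/
theorem exists_stable_of_fintype {X Y : Type*} [Fintype X] [Fintype Y]
    (u v : X → Y → ℝ) (wX : X → ℝ) (wY : Y → ℝ) :
    ∃ f : Y → Option X,
      (∀ x y y', f y = some x → f y' = some x → y = y') ∧
      (∀ x y, f y = some x → wX x ≤ u x y ∧ wY y ≤ v x y) ∧
      (∀ x y y', f y' = some x → u x y > u x y' → v x y ≤ (f y).elim (wY y) (v · y)) ∧
      (∀ x y, (∀ y', f y' ≠ some x) → u x y > wX x →
        v x y ≤ (f y).elim (wY y) (v · y)) := by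
  let Q : Set (Y → Option X) := {f |
    (∀ x y y', f y = some x → f y' = some x → y = y') ∧
    (∀ x y, f y = some x → wX x ≤ u x y ∧ wY y ≤ v x y) ∧
    (∀ x y y', f y' = some x → u x y > u x y' → v x y ≤ (f y).elim (wY y) (v · y))}
  have hne : Q.Nonempty := ⟨fun _ => none, by simp [Q]⟩
  obtain ⟨f, hf, hmax⟩ := Set.exists_max_image Q
    (fun f => ∑ y, (f y).elim (wY y) (v · y)) (Set.toFinite _) hne
  obtain ⟨hinj, hir, hq⟩ := hf
  refine ⟨f, hinj, hir, hq, ?_⟩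
  intro x y₀ hx hy₀
  by_contra! hv₀
  obtain ⟨y, hy, hbest⟩ := Set.exists_max_image
    {y | u x y > wX x ∧ (f y).elim (wY y) (v · y) < v x y} (fun y => u x y)
    (Set.toFinite _) ⟨y₀, hy₀, hv₀⟩
  obtain ⟨huy, hvy⟩ := hy
  have hle : ∀ z, (f z).elim (wY z) (v · z) ≤
      (Function.update f y (some x) z).elim (wY z) (v · z) := by
    intro z
    by_cases hz : z = y
    · subst hz; simpa using hvy.le
    · simp [Function.update_of_ne hz]
  have hwy : wY y ≤ v x y := by
    refine le_trans ?_ hvy.le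
    rcases h : f y with _ | x'
    · simp
    · simpa [h] using (hir x' y h).2
  have hmem : Function.update f y (some x) ∈ Q := by
    refine ⟨?_, ?_, ?_⟩
    · intro a z z' h h'
      by_cases hz : z = y <;> by_cases hz' : z' = y <;>
        grind [Function.update_apply]
    · intro a z h
      by_cases hz : z = y
      · subst hz
        simp only [Function.update_self, Option.some.injEq] at h
        subst h
        exact ⟨huy.le, hwy⟩
      · rw [Function.update_of_ne hz] at h
        exact hir a z h
    · intro a z z' h hu
      refine le_trans ?_ (hle z)
      by_cases hz' : z' = y
      · subst hz'
        simp only [Function.update_self, Option.some.injEq] at h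
        subst h
        by_contra! hlt
        exact absurd (hbest z ⟨huy.trans hu, hlt⟩) (not_le.mpr hu)
      · rw [Function.update_of_ne hz'] at h
        exact hq a z z' h hu
  refine absurd (hmax _ hmem) (not_le.mpr ?_)
  refine Finset.sum_lt_sum (fun z _ => hle z) ⟨y, Finset.mem_univ _, ?_⟩
  simpa using hvy

/-- The first time at or after `t` at which `f` is defined. -/
theorem sInf_eq_of_first {Y : Type*} {f : ℕ → Option Y} {t r : ℕ} (htr : t ≤ r)
    (hr : f r ≠ none) (hlt : ∀ q, t ≤ q → q < r → f q = none) :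
    sInf {s | t ≤ s ∧ f s ≠ none} = r := by
  refine le_antisymm (Nat.sInf_le ⟨htr, hr⟩) ?_
  obtain ⟨h1, h2⟩ := Nat.sInf_mem (s := {s | t ≤ s ∧ f s ≠ none}) ⟨r, htr, hr⟩
  by_contra! h
  exact h2 (hlt _ h1 h)

theorem exists_first {Y : Type*} {f : ℕ → Option Y} {t T : ℕ} (ht : t ≤ T)
    (hf : f T ≠ none) :
    ∃ r, t ≤ r ∧ r ≤ T ∧ f r ≠ none ∧ ∀ q, t ≤ q → q < r → f q = none := by
  have hne : {s | t ≤ s ∧ f s ≠ none}.Nonempty := ⟨T, ht, hf⟩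
  obtain ⟨h1, h2⟩ := Nat.sInf_mem hne
  refine ⟨_, h1, Nat.sInf_le ⟨ht, hf⟩, h2, fun q hq hlt => ?_⟩
  by_contra h
  exact absurd (Nat.sInf_le (s := {s | t ≤ s ∧ f s ≠ none}) ⟨hq, h⟩) (not_le.mpr hlt)

/-- The discounted payoff of an agent with discount factor `d` and utility `w` whose partner
in period `s` is `f s`. -/
def payoff {Y : Type*} (d : ℝ) (w : Y → ℝ) (f : ℕ → Option Y) (T t : ℕ) : ℝ :=
  match f (T - 1) with
  | none => 0
  | some y => d ^ (min (sInf {s | t ≤ s ∧ f s ≠ none}) T - t) * w y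

theorem Upay_eq_payoff (P : Pref A B) (E : Economy A B) (m : PreMatching A B) (t : ℕ) (a : A) :
    Upay P E m t a = payoff (P.dA a) (P.u a) (fun s => m.mA s a) E.T t := rfl

theorem Vpay_eq_payoff (P : Pref A B) (E : Economy A B) (m : PreMatching A B) (t : ℕ) (b : B) :
    Vpay P E m t b = payoff (P.dB b) (P.v · b) (fun s => m.mB s b) E.T t := rfl

theorem payoff_of_none {Y : Type*} {d : ℝ} {w : Y → ℝ} {f : ℕ → Option Y} {T t : ℕ}
    (h : f (T - 1) = none) : payoff d w f T t = 0 := by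
  simp [payoff, h]

theorem payoff_of_some {Y : Type*} {d : ℝ} {w : Y → ℝ} {f : ℕ → Option Y} {T t : ℕ} {y : Y}
    (h : f t = some y) (hT : f (T - 1) = some y) : payoff d w f T t = w y := by
  have hs : sInf {s | t ≤ s ∧ f s ≠ none} = t :=
    sInf_eq_of_first le_rfl (by simp [h]) (fun q h1 h2 => by omega)
  have he : min t T - t = 0 := by omega
  simp only [payoff, hT, hs, he, pow_zero, one_mul]

theorem payoff_congr {Y : Type*} {d : ℝ} {w : Y → ℝ} {f g : ℕ → Option Y} {T t : ℕ}
    (hT : 0 < T) (h : ∀ s, s < T → f s = g s) : payoff d w f T t = payoff d w g T t := by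
  have hl := h (T - 1) (by omega)
  rcases hg : g (T - 1) with _ | y
  · rw [payoff_of_none hg, payoff_of_none (hl.trans hg)]
  · have hf := hl.trans hg
    have he : min (sInf {s | t ≤ s ∧ f s ≠ none}) T - t =
        min (sInf {s | t ≤ s ∧ g s ≠ none}) T - t := by
      by_cases ht : t ≤ T - 1
      · obtain ⟨r, h1, h2, h3, h4⟩ := exists_first (f := g) ht (by simp [hg])
        rw [sInf_eq_of_first h1 h3 h4, sInf_eq_of_first (f := f) h1
          (by rwa [h r (by omega)]) (fun q h5 h6 => by rw [h q (by omega)]; exact h4 q h5 h6)]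
      · omega
    simp only [payoff, hf, hg, he]

theorem payoff_shift {Y : Type*} {d : ℝ} {w : Y → ℝ} {f g : ℕ → Option Y} {n t : ℕ}
    (hn : 0 < n) (h : ∀ s, s < n → g s = f (s + 1)) :
    payoff d w f (n + 1) (t + 1) = payoff d w g n t := by
  have hl : g (n - 1) = f (n + 1 - 1) := by
    rw [h (n - 1) (by omega)]; congr 1; omega
  rcases hg : g (n - 1) with _ | y
  · rw [payoff_of_none hg, payoff_of_none (hl.symm.trans hg)]
  · have hf := hl.symm.trans hg
    have he : min (sInf {s | t + 1 ≤ s ∧ f s ≠ none}) (n + 1) - (t + 1) =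
        min (sInf {s | t ≤ s ∧ g s ≠ none}) n - t := by
      by_cases ht : t ≤ n - 1
      · obtain ⟨r, h1, h2, h3, h4⟩ := exists_first (f := g) ht (by simp [hg])
        rw [sInf_eq_of_first h1 h3 h4, sInf_eq_of_first (f := f) (r := r + 1) (by omega)
          (by rwa [← h r (by omega)]) ?_]
        · omega
        · intro q h5 h6
          obtain ⟨p, rfl⟩ : ∃ p, q = p + 1 := ⟨q - 1, by omega⟩
          rw [← h p (by omega)]
          exact h4 p (by omega) (by omega)
      · omega
    simp only [payoff, hf, hg, he]

/-- Payoffs from partners in a finite set take finitely many values. -/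
theorem finite_payoff {Y : Type*} (d : ℝ) (w : Y → ℝ) (T t : ℕ) (S : Finset Y) :
    {x | ∃ f : ℕ → Option Y, (∀ y, f (T - 1) = some y → y ∈ S) ∧
      payoff d w f T t = x}.Finite := by
  refine Set.Finite.subset (((Finset.finite_toSet S).prod (Set.finite_Iic T)).image
    (fun p => d ^ p.2 * w p.1) |>.insert 0) ?_
  rintro x ⟨f, hf, rfl⟩
  rcases h : f (T - 1) with _ | y
  · exact Or.inl (payoff_of_none h)
  · refine Or.inr ⟨(y, min (sInf {s | t ≤ s ∧ f s ≠ none}) T - t), ⟨hf y h, ?_⟩, ?_⟩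
    · exact (Nat.sub_le _ _).trans (min_le_right _ _)
    · simp only [payoff, h]

theorem agreeUpTo.symm {m m' : PreMatching A B} {t : ℕ} (h : agreeUpTo m m' t) :
    agreeUpTo m' m t :=
  fun s hs => ⟨fun a => ((h s hs).1 a).symm, fun b => ((h s hs).2 b).symm⟩

theorem agreeUpTo.trans {m m' m'' : PreMatching A B} {t : ℕ} (h : agreeUpTo m m' t)
    (h' : agreeUpTo m' m'' t) : agreeUpTo m m'' t :=
  fun s hs => ⟨fun a => ((h s hs).1 a).trans ((h' s hs).1 a),
    fun b => ((h s hs).2 b).trans ((h' s hs).2 b)⟩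

theorem agreeUpTo.mono {m m' : PreMatching A B} {s t : ℕ} (h : agreeUpTo m m' t) (hst : s ≤ t) :
    agreeUpTo m m' s :=
  fun r hr => h r (hr.trans_le hst)

theorem availA_congr {E : Economy A B} {m m' : PreMatching A B} {t : ℕ}
    (h : agreeUpTo m m' t) : availA E m t = availA E m' t := by
  ext a
  simp only [availA, Finset.mem_filter]
  exact and_congr_right fun _ => forall₂_congr fun s hs => by rw [(h s hs).1 a]

theorem availB_congr {E : Economy A B} {m m' : PreMatching A B} {t : ℕ}
    (h : agreeUpTo m m' t) : availB E m t = availB E m' t := by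
  ext b
  simp only [availB, Finset.mem_filter]
  exact and_congr_right fun _ => forall₂_congr fun s hs => by rw [(h s hs).2 b]

theorem contEconomy_congr {E : Economy A B} {m m' : PreMatching A B} {t : ℕ}
    (h : agreeUpTo m m' t) : contEconomy E m t = contEconomy E m' t := by
  simp only [contEconomy, availA_congr h, availB_congr h]

theorem MSet_congr {E : Economy A B} {m m' : PreMatching A B} {t : ℕ}
    (h : agreeUpTo m m' t) (k : Agent A B) : MSet E m t k = MSet E m' t k := by
  ext x
  exact and_congr_right fun _ => and_congr_left fun _ =>
    ⟨fun hx => h.symm.trans hx, fun hx => h.trans hx⟩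

theorem cvrIter_congr {P : Pref A B} {E : Economy A B} {DS : Economy A B → Set (PreMatching A B)}
    {m m' : PreMatching A B} {t : ℕ} (h : agreeUpTo m m' t) (n : ℕ) :
    cvrIter P E DS t m n = cvrIter P E DS t m' n := by
  induction n with
  | zero => funext k; exact MSet_congr h k
  | succ n ih =>
    funext k
    simp only [cvrIter, ih, MSet_congr h k, StableAmongMatched, availA_congr h, availB_congr h]

theorem cvrConj_congr {P : Pref A B} {E : Economy A B} {DS : Economy A B → Set (PreMatching A B)}
    {m m' : PreMatching A B} {t : ℕ} (h : agreeUpTo m m' t) :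
    cvrConj P DS E t m = cvrConj P DS E t m' := by
  funext k
  simp only [cvrConj, cvrIter_congr h]

theorem Upay_congr {P : Pref A B} {E : Economy A B} {m m' : PreMatching A B} (hT : 0 < E.T)
    (h : agreeUpTo m m' E.T) (t : ℕ) (a : A) : Upay P E m t a = Upay P E m' t a :=
  payoff_congr hT fun s hs => (h s hs).1 a

theorem Vpay_congr {P : Pref A B} {E : Economy A B} {m m' : PreMatching A B} (hT : 0 < E.T)
    (h : agreeUpTo m m' E.T) (t : ℕ) (b : B) : Vpay P E m t b = Vpay P E m' t b :=
  payoff_congr hT fun s hs => (h s hs).2 b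

theorem IsMatching.congr {E : Economy A B} {m m' : PreMatching A B} (hm : IsMatching E m)
    (h : agreeUpTo m m' E.T) : IsMatching E m' := by
  obtain ⟨h1, h2, h3, h4, h5⟩ := hm
  refine ⟨fun t a b ht => ?_, fun t a ht => ?_, fun t a b ht => ?_, fun t s a hts hs => ?_,
    fun t s b hts hs => ?_⟩
  · rw [← (h t ht).1, ← (h t ht).2]; exact h1 t a b ht
  · rw [← (h t ht).1]; exact h2 t a ht
  · rw [← (h t ht).1]; exact h3 t a b ht
  · rw [← (h t (by omega)).1, ← (h s hs).1]; exact h4 t s a hts hs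
  · rw [← (h t (by omega)).2, ← (h s hs).2]; exact h5 t s b hts hs

/-- CVR-dynamic stability does not depend on matchings outside the horizon. -/
theorem IsCVRFamily.mem_congr {P : Pref A B} {DS : Economy A B → Set (PreMatching A B)}
    (hDS : IsCVRFamily P DS) {E : Economy A B} {m m' : PreMatching A B}
    (h : agreeUpTo m m' E.T) (hm : m ∈ DS E) : m' ∈ DS E := by
  rcases Nat.lt_trichotomy E.T 1 with hT | hT | hT
  · rw [hDS.1 E (by omega)]; trivial
  · rw [hDS.2.1 E hT] at hm ⊢
    obtain ⟨h1, h2, h3, h4⟩ := hm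
    refine ⟨h1.congr h, fun a b => ?_, fun b a => ?_, fun a ha b hb => ?_⟩
    · rw [← (h _ (by omega)).1]; exact h2 a b
    · rw [← (h _ (by omega)).2]; exact h3 b a
    · rw [← Upay_congr (by omega) h, ← Vpay_congr (by omega) h]; exact h4 a ha b hb
  · rw [hDS.2.2 E hT] at hm ⊢
    refine ⟨hm.1.congr h, fun t ht => ?_⟩
    have ht' := h.mono ht.le
    simp only [← availA_congr ht', ← availB_congr ht', ← cvrConj_congr ht',
      ← Upay_congr (by omega : 0 < E.T) h, ← Vpay_congr (by omega : 0 < E.T) h]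
    exact hm.2 t ht

/-- Arrivals of different periods are disjoint. -/
def Economy.DisjointArrivals (E : Economy A B) : Prop :=
  (∀ s t, s ≠ t → Disjoint (E.arrA s) (E.arrA t)) ∧
  (∀ s t, s ≠ t → Disjoint (E.arrB s) (E.arrB t))

theorem mem_arrAUpTo {E : Economy A B} {t : ℕ} {a : A} :
    a ∈ arrAUpTo E t ↔ ∃ s, s ≤ t ∧ a ∈ E.arrA s := by
  simp [arrAUpTo]

theorem mem_arrBUpTo {E : Economy A B} {t : ℕ} {b : B} :
    b ∈ arrBUpTo E t ↔ ∃ s, s ≤ t ∧ b ∈ E.arrB s := by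
  simp [arrBUpTo]

theorem IsMatching.mem_arrBUpTo {E : Economy A B} {m : PreMatching A B} (hm : IsMatching E m)
    {t : ℕ} (ht : t < E.T) {b : B} (hb : m.mB t b ≠ none) : b ∈ arrBUpTo E t := by
  obtain ⟨a, ha⟩ := Option.ne_none_iff_exists'.mp hb
  exact hm.2.2.1 t a b ht ((hm.1 t a b ht).mpr ha)

theorem mem_availA_one {E : Economy A B} {m : PreMatching A B} {a : A} :
    a ∈ availA E m 1 ↔ (a ∈ E.arrA 0 ∨ a ∈ E.arrA 1) ∧ m.mA 0 a = none := by
  simp [availA, arrAUpTo, Finset.range_add_one, or_comm]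

theorem mem_availB_one {E : Economy A B} {m : PreMatching A B} {b : B} :
    b ∈ availB E m 1 ↔ (b ∈ E.arrB 0 ∨ b ∈ E.arrB 1) ∧ m.mB 0 b = none := by
  simp [availB, arrBUpTo, Finset.range_add_one, or_comm]

theorem mem_arrAUpTo_contEconomy_one {E : Economy A B} (hE : E.DisjointArrivals) (hT : 0 < E.T)
    {m : PreMatching A B} (hm : IsMatching E m) {t : ℕ} {a : A} :
    a ∈ arrAUpTo (contEconomy E m 1) t ↔ a ∈ arrAUpTo E (t + 1) ∧ m.mA 0 a = none := by
  simp only [mem_arrAUpTo, contEconomy]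
  constructor
  · rintro ⟨s, hs, ha⟩
    split_ifs at ha with h0
    · obtain ⟨h1 | h1, h2⟩ := mem_availA_one.mp ha
      · exact ⟨⟨0, by omega, h1⟩, h2⟩
      · exact ⟨⟨1, by omega, h1⟩, h2⟩
    · refine ⟨⟨1 + s, by omega, ha⟩, ?_⟩
      by_contra h
      obtain ⟨r, hr, har⟩ := mem_arrAUpTo.mp (hm.2.1 0 a hT h)
      exact Finset.disjoint_left.mp (hE.1 r (1 + s) (by omega)) har ha
  · rintro ⟨⟨s, hs, ha⟩, h0⟩
    by_cases h1 : s ≤ 1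
    · refine ⟨0, by omega, ?_⟩
      rw [if_pos rfl, mem_availA_one]
      interval_cases s <;> simp [ha, h0]
    · refine ⟨s - 1, by omega, ?_⟩
      rwa [if_neg (by omega), show 1 + (s - 1) = s by omega]

theorem mem_arrBUpTo_contEconomy_one {E : Economy A B} (hE : E.DisjointArrivals) (hT : 0 < E.T)
    {m : PreMatching A B} (hm : IsMatching E m) {t : ℕ} {b : B} :
    b ∈ arrBUpTo (contEconomy E m 1) t ↔ b ∈ arrBUpTo E (t + 1) ∧ m.mB 0 b = none := by
  simp only [mem_arrBUpTo, contEconomy]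
  constructor
  · rintro ⟨s, hs, hb⟩
    split_ifs at hb with h0
    · obtain ⟨h1 | h1, h2⟩ := mem_availB_one.mp hb
      · exact ⟨⟨0, by omega, h1⟩, h2⟩
      · exact ⟨⟨1, by omega, h1⟩, h2⟩
    · refine ⟨⟨1 + s, by omega, hb⟩, ?_⟩
      by_contra h
      obtain ⟨r, hr, hbr⟩ := DynMatch.mem_arrBUpTo.mp (hm.mem_arrBUpTo hT h)
      exact Finset.disjoint_left.mp (hE.2 r (1 + s) (by omega)) hbr hb
  · rintro ⟨⟨s, hs, hb⟩, h0⟩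
    by_cases h1 : s ≤ 1
    · refine ⟨0, by omega, ?_⟩
      rw [if_pos rfl, mem_availB_one]
      interval_cases s <;> simp [hb, h0]
    · refine ⟨s - 1, by omega, ?_⟩
      rwa [if_neg (by omega), show 1 + (s - 1) = s by omega]

theorem Economy.DisjointArrivals.contEconomy_one {E : Economy A B} (hE : E.DisjointArrivals)
    (m : PreMatching A B) : (contEconomy E m 1).DisjointArrivals := by
  have hA : ∀ s, s ≠ 0 → Disjoint (availA E m 1) (E.arrA (1 + s)) := fun s hs => by
    rw [Finset.disjoint_left]
    intro a ha ha'
    rcases (mem_availA_one.mp ha).1 with h | h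
    · exact Finset.disjoint_left.mp (hE.1 0 (1 + s) (by omega)) h ha'
    · exact Finset.disjoint_left.mp (hE.1 1 (1 + s) (by omega)) h ha'
  have hB : ∀ s, s ≠ 0 → Disjoint (availB E m 1) (E.arrB (1 + s)) := fun s hs => by
    rw [Finset.disjoint_left]
    intro b hb hb'
    rcases (mem_availB_one.mp hb).1 with h | h
    · exact Finset.disjoint_left.mp (hE.2 0 (1 + s) (by omega)) h hb'
    · exact Finset.disjoint_left.mp (hE.2 1 (1 + s) (by omega)) h hb'
  constructor
  · intro s t hst
    by_cases hs : s = 0 <;> by_cases ht : t = 0 <;>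
      simp only [contEconomy, hs, ht, if_true, if_false]
    · omega
    · exact hA t ht
    · exact (hA s hs).symm
    · exact hE.1 _ _ (by omega)
  · intro s t hst
    by_cases hs : s = 0 <;> by_cases ht : t = 0 <;>
      simp only [contEconomy, hs, ht, if_true, if_false]
    · omega
    · exact hB t ht
    · exact (hB s hs).symm
    · exact hE.2 _ _ (by omega)

/-- `m'` is, for the first `n` periods, the continuation of `m` from the second period onward,
with agents matched by `m` in the first period dropped. -/
structure ShiftRel (n : ℕ) (m m' : PreMatching A B) : Prop where
  noneA : ∀ s, s < n → ∀ a, m.mA 0 a = none → m'.mA s a = m.mA (s + 1) a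
  matchedA : ∀ s, s < n → ∀ a, m.mA 0 a ≠ none → m'.mA s a = none ∧ m.mA (s + 1) a = m.mA 0 a
  noneB : ∀ s, s < n → ∀ b, m.mB 0 b = none → m'.mB s b = m.mB (s + 1) b
  matchedB : ∀ s, s < n → ∀ b, m.mB 0 b ≠ none → m'.mB s b = none ∧ m.mB (s + 1) b = m.mB 0 b

theorem IsMatching.shiftRel_restrictM {E : Economy A B} {m : PreMatching A B}
    (hm : IsMatching E m) {n : ℕ} (hT : E.T = n + 1) : ShiftRel n m (restrictM m 1) where
  noneA s hs a h := by simp [restrictM, h, add_comm]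
  matchedA s hs a h := by
    simp only [restrictM, Nat.lt_one_iff, forall_eq, if_neg h, true_and]
    exact hm.2.2.2.1 0 (s + 1) a (by omega) (by omega) h
  noneB s hs b h := by simp [restrictM, h, add_comm]
  matchedB s hs b h := by
    simp only [restrictM, Nat.lt_one_iff, forall_eq, if_neg h, true_and]
    exact hm.2.2.2.2 0 (s + 1) b (by omega) (by omega) h

theorem agreeUpTo_splice (m m' : PreMatching A B) (t : ℕ) : agreeUpTo m (splice m m' t) t :=
  fun s hs => by simp [splice, hs]

theorem IsMatching.shiftRel_splice {E : Economy A B} (hE : E.DisjointArrivals)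
    {m m' : PreMatching A B} (hm : IsMatching E m) (hm' : IsMatching (contEconomy E m 1) m')
    {n : ℕ} (hT : E.T = n + 1) : ShiftRel n (splice m m' 1) m' where
  noneA s hs a h := by
    have h' : m.mA 0 a = none := by simpa [splice] using h
    simp [splice, h']
  matchedA s hs a h := by
    have h' : m.mA 0 a ≠ none := by simpa [splice] using h
    refine ⟨?_, by simp [splice, h']⟩
    by_contra hc
    exact h' ((mem_arrAUpTo_contEconomy_one hE (by omega) hm).mp
      (hm'.2.1 s a (by simp only [contEconomy]; omega) hc)).2
  noneB s hs b h := by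
    have h' : m.mB 0 b = none := by simpa [splice] using h
    simp [splice, h']
  matchedB s hs b h := by
    have h' : m.mB 0 b ≠ none := by simpa [splice] using h
    refine ⟨?_, by simp [splice, h']⟩
    by_contra hc
    exact h' ((mem_arrBUpTo_contEconomy_one hE (by omega) hm).mp
      (hm'.mem_arrBUpTo (by simp only [contEconomy]; omega) hc)).2

section Shift

variable {E : Economy A B} {m x y : PreMatching A B} {n : ℕ}

theorem ShiftRel.isMatching_right (hE : E.DisjointArrivals) (hT : E.T = n + 1)
    (hx : IsMatching E x) (h : ShiftRel n x y) : IsMatching (contEconomy E x 1) y := by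
  have hT' : (contEconomy E x 1).T = n := by simp [contEconomy, hT]
  obtain ⟨h1, h2, h3, h4, h5⟩ := id hx
  have key : ∀ t, t < n → ∀ a b, y.mA t a = some b ↔ y.mB t b = some a := by
    intro t ht a b
    have e1 := h1 (t + 1) a b (by omega)
    have e0 := h1 0 a b (by omega)
    by_cases ha : x.mA 0 a = none <;> by_cases hb : x.mB 0 b = none
    · rw [h.noneA t ht a ha, h.noneB t ht b hb, e1]
    · rw [h.noneA t ht a ha, (h.matchedB t ht b hb).1, e1, (h.matchedB t ht b hb).2, ← e0]
      simp [ha]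
    · rw [h.noneB t ht b hb, (h.matchedA t ht a ha).1, ← e1, (h.matchedA t ht a ha).2, e0]
      simp [hb]
    · rw [(h.matchedA t ht a ha).1, (h.matchedB t ht b hb).1]; simp
  have hA : ∀ t, t < n → ∀ a, y.mA t a ≠ none →
      x.mA 0 a = none ∧ y.mA t a = x.mA (t + 1) a := by
    intro t ht a ha
    by_cases h0 : x.mA 0 a = none
    · exact ⟨h0, h.noneA t ht a h0⟩
    · exact absurd (h.matchedA t ht a h0).1 ha
  have hB : ∀ t, t < n → ∀ b, y.mB t b ≠ none →
      x.mB 0 b = none ∧ y.mB t b = x.mB (t + 1) b := by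
    intro t ht b hb
    by_cases h0 : x.mB 0 b = none
    · exact ⟨h0, h.noneB t ht b h0⟩
    · exact absurd (h.matchedB t ht b h0).1 hb
  unfold IsMatching
  rw [hT']
  refine ⟨fun t a b ht => key t ht a b, fun t a ht ha => ?_, fun t a b ht hab => ?_,
    fun t s a hts hs ha => ?_, fun t s b hts hs hb => ?_⟩
  · obtain ⟨h0, e⟩ := hA t ht a ha
    exact (mem_arrAUpTo_contEconomy_one hE (by omega) hx).mpr
      ⟨h2 (t + 1) a (by omega) (e ▸ ha), h0⟩
  · have hb : y.mB t b ≠ none := by simp [(key t ht a b).mp hab]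
    obtain ⟨h0, e⟩ := hB t ht b hb
    exact (mem_arrBUpTo_contEconomy_one hE (by omega) hx).mpr
      ⟨hx.mem_arrBUpTo (by omega) (e ▸ hb), h0⟩
  · obtain ⟨h0, e⟩ := hA t (by omega) a ha
    rw [e, h.noneA s hs a h0]
    exact h4 (t + 1) (s + 1) a (by omega) (by omega) (e ▸ ha)
  · obtain ⟨h0, e⟩ := hB t (by omega) b hb
    rw [e, h.noneB s hs b h0]
    exact h5 (t + 1) (s + 1) b (by omega) (by omega) (e ▸ hb)

theorem ShiftRel.isMatching_left (hE : E.DisjointArrivals) (hT : E.T = n + 1)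
    (hm : IsMatching E m) (hmx : agreeUpTo m x 1) (h : ShiftRel n x y)
    (hy : IsMatching (contEconomy E m 1) y) : IsMatching E x := by
  have hT' : (contEconomy E m 1).T = n := by simp [contEconomy, hT]
  have hA0 : ∀ a, m.mA 0 a = x.mA 0 a := (hmx 0 one_pos).1
  have hB0 : ∀ b, m.mB 0 b = x.mB 0 b := (hmx 0 one_pos).2
  obtain ⟨h1, h2, h3, h4, h5⟩ := id hm
  obtain ⟨k1, k2, k3, k4, k5⟩ := id hy
  rw [hT'] at k1 k2 k3 k4 k5
  have e0 : ∀ a b, x.mA 0 a = some b ↔ x.mB 0 b = some a := fun a b => by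
    rw [← hA0, ← hB0]; exact h1 0 a b (by omega)
  have key : ∀ t, t < E.T → ∀ a b, x.mA t a = some b ↔ x.mB t b = some a := by
    rintro (_ | t) ht a b
    · exact e0 a b
    have ht' : t < n := by omega
    have e1 := k1 t a b ht'
    by_cases ha : x.mA 0 a = none <;> by_cases hb : x.mB 0 b = none
    · rw [← h.noneA t ht' a ha, ← h.noneB t ht' b hb, e1]
    · rw [← h.noneA t ht' a ha, (h.matchedB t ht' b hb).2, e1, (h.matchedB t ht' b hb).1,
        ← e0]
      simp [ha]
    · rw [← h.noneB t ht' b hb, (h.matchedA t ht' a ha).2, ← e1, (h.matchedA t ht' a ha).1, e0]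
      simp [hb]
    · rw [(h.matchedA t ht' a ha).2, (h.matchedB t ht' b hb).2, e0]
  have upA : ∀ t, t < E.T → ∀ a, x.mA t a ≠ none → a ∈ arrAUpTo E t := by
    intro t ht a ha
    by_cases h0 : x.mA 0 a = none
    · obtain _ | t := t
      · exact absurd h0 ha
      · rw [← h.noneA t (by omega) a h0] at ha
        exact ((mem_arrAUpTo_contEconomy_one hE (by omega) hm).mp (k2 t a (by omega) ha)).1
    · obtain ⟨s, hs, hs'⟩ := mem_arrAUpTo.mp (h2 0 a (by omega) (hA0 a ▸ h0))
      exact mem_arrAUpTo.mpr ⟨s, by omega, hs'⟩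
  have upB : ∀ t, t < E.T → ∀ b, x.mB t b ≠ none → b ∈ arrBUpTo E t := by
    intro t ht b hb
    by_cases h0 : x.mB 0 b = none
    · obtain _ | t := t
      · exact absurd h0 hb
      · rw [← h.noneB t (by omega) b h0] at hb
        exact ((mem_arrBUpTo_contEconomy_one hE (by omega) hm).mp
          (hy.mem_arrBUpTo (by omega) hb)).1
    · obtain ⟨s, hs, hs'⟩ := mem_arrBUpTo.mp (hm.mem_arrBUpTo (t := 0) (by omega) (hB0 b ▸ h0))
      exact mem_arrBUpTo.mpr ⟨s, by omega, hs'⟩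
  refine ⟨fun t a b ht => key t ht a b, fun t a ht => upA t ht a,
    fun t a b ht hab => upB t ht b (by simp [(key t ht a b).mp hab]),
    fun t s a hts hs ha => ?_, fun t s b hts hs hb => ?_⟩
  · obtain _ | s := s
    · rw [Nat.le_zero.mp hts]
    by_cases h0 : x.mA 0 a = none
    · obtain _ | t := t
      · exact absurd h0 ha
      · rw [← h.noneA t (by omega) a h0] at ha ⊢
        rw [← h.noneA s (by omega) a h0]
        exact k4 t s a (by omega) (by omega) ha
    · obtain _ | t := t
      · exact (h.matchedA s (by omega) a h0).2
      · rw [(h.matchedA s (by omega) a h0).2, (h.matchedA t (by omega) a h0).2]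
  · obtain _ | s := s
    · rw [Nat.le_zero.mp hts]
    by_cases h0 : x.mB 0 b = none
    · obtain _ | t := t
      · exact absurd h0 hb
      · rw [← h.noneB t (by omega) b h0] at hb ⊢
        rw [← h.noneB s (by omega) b h0]
        exact k5 t s b (by omega) (by omega) hb
    · obtain _ | t := t
      · exact (h.matchedB s (by omega) b h0).2
      · rw [(h.matchedB s (by omega) b h0).2, (h.matchedB t (by omega) b h0).2]

theorem ShiftRel.forall_mA_none (h : ShiftRel n x y) {s : ℕ} (hs : s ≤ n) (a : A) :
    (∀ r, r < s + 1 → x.mA r a = none) ↔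
      x.mA 0 a = none ∧ ∀ r, r < s → y.mA r a = none := by
  constructor
  · intro hr
    have h0 := hr 0 (by omega)
    exact ⟨h0, fun r hrs => by rw [h.noneA r (by omega) a h0]; exact hr _ (by omega)⟩
  · rintro ⟨h0, hr⟩ (_ | r) hrs
    · exact h0
    · rw [← h.noneA r (by omega) a h0]; exact hr r (by omega)

theorem ShiftRel.forall_mB_none (h : ShiftRel n x y) {s : ℕ} (hs : s ≤ n) (b : B) :
    (∀ r, r < s + 1 → x.mB r b = none) ↔
      x.mB 0 b = none ∧ ∀ r, r < s → y.mB r b = none := by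
  constructor
  · intro hr
    have h0 := hr 0 (by omega)
    exact ⟨h0, fun r hrs => by rw [h.noneB r (by omega) b h0]; exact hr _ (by omega)⟩
  · rintro ⟨h0, hr⟩ (_ | r) hrs
    · exact h0
    · rw [← h.noneB r (by omega) b h0]; exact hr r (by omega)

theorem ShiftRel.availA_eq (hE : E.DisjointArrivals) (hT : E.T = n + 1)
    (hx : IsMatching E x) (h : ShiftRel n x y) {s : ℕ} (hs : s ≤ n) :
    availA (contEconomy E x 1) y s = availA E x (s + 1) := by
  ext a
  simp only [availA, Finset.mem_filter, h.forall_mA_none hs,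
    mem_arrAUpTo_contEconomy_one hE (by omega : 0 < E.T) hx]
  tauto

theorem ShiftRel.availB_eq (hE : E.DisjointArrivals) (hT : E.T = n + 1)
    (hx : IsMatching E x) (h : ShiftRel n x y) {s : ℕ} (hs : s ≤ n) :
    availB (contEconomy E x 1) y s = availB E x (s + 1) := by
  ext b
  simp only [availB, Finset.mem_filter, h.forall_mB_none hs,
    mem_arrBUpTo_contEconomy_one hE (by omega : 0 < E.T) hx]
  tauto

theorem ShiftRel.contEconomy_eq (hE : E.DisjointArrivals) (hT : E.T = n + 1)
    (hx : IsMatching E x) (h : ShiftRel n x y) {s : ℕ} (hs : s ≤ n) :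
    contEconomy (contEconomy E x 1) y s = contEconomy E x (s + 1) := by
  have hA := h.availA_eq hE hT hx hs
  have hB := h.availB_eq hE hT hx hs
  unfold contEconomy at hA hB ⊢
  simp only [hA, hB]
  congr 1
  · omega
  · funext r
    by_cases hr : r = 0
    · simp [hr]
    · rw [if_neg hr, if_neg hr, if_neg (by omega), show 1 + (s + r) = s + 1 + r by omega]
  · funext r
    by_cases hr : r = 0
    · simp [hr]
    · rw [if_neg hr, if_neg hr, if_neg (by omega), show 1 + (s + r) = s + 1 + r by omega]

theorem ShiftRel.agreeUpTo_restrictM (h : ShiftRel n x y) {s : ℕ} (hs : s ≤ n) :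
    agreeUpTo (restrictM x (s + 1)) (restrictM y s) (n - s) := by
  intro r hr
  constructor
  · intro a
    simp only [restrictM, h.forall_mA_none hs]
    by_cases h0 : x.mA 0 a = none
    · simp only [h0, true_and, h.noneA (s + r) (by omega) a h0,
        show s + 1 + r = s + r + 1 by omega]
    · simp [h0, (h.matchedA (s + r) (by omega) a h0).1]
  · intro b
    simp only [restrictM, h.forall_mB_none hs]
    by_cases h0 : x.mB 0 b = none
    · simp only [h0, true_and, h.noneB (s + r) (by omega) b h0,
        show s + 1 + r = s + r + 1 by omega]
    · simp [h0, (h.matchedB (s + r) (by omega) b h0).1]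

theorem ShiftRel.agreeUpTo_iff {x' y' : PreMatching A B} (h : ShiftRel n x y)
    (h' : ShiftRel n x' y') (h0 : agreeUpTo x x' 1) {s : ℕ} (hs : s ≤ n) :
    agreeUpTo x x' (s + 1) ↔ agreeUpTo y y' s := by
  obtain ⟨hA0, hB0⟩ := h0 0 one_pos
  constructor
  · intro hx r hr
    constructor
    · intro a
      by_cases ha : x.mA 0 a = none
      · rw [h.noneA r (by omega) a ha, h'.noneA r (by omega) a (hA0 a ▸ ha)]
        exact (hx (r + 1) (by omega)).1 a
      · rw [(h.matchedA r (by omega) a ha).1, (h'.matchedA r (by omega) a (hA0 a ▸ ha)).1]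
    · intro b
      by_cases hb : x.mB 0 b = none
      · rw [h.noneB r (by omega) b hb, h'.noneB r (by omega) b (hB0 b ▸ hb)]
        exact (hx (r + 1) (by omega)).2 b
      · rw [(h.matchedB r (by omega) b hb).1, (h'.matchedB r (by omega) b (hB0 b ▸ hb)).1]
  · rintro hy (_ | r) hr
    · exact ⟨hA0, hB0⟩
    constructor
    · intro a
      by_cases ha : x.mA 0 a = none
      · rw [← h.noneA r (by omega) a ha, ← h'.noneA r (by omega) a (hA0 a ▸ ha)]
        exact (hy r (by omega)).1 a
      · rw [(h.matchedA r (by omega) a ha).2, (h'.matchedA r (by omega) a (hA0 a ▸ ha)).2, hA0]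
    · intro b
      by_cases hb : x.mB 0 b = none
      · rw [← h.noneB r (by omega) b hb, ← h'.noneB r (by omega) b (hB0 b ▸ hb)]
        exact (hy r (by omega)).2 b
      · rw [(h.matchedB r (by omega) b hb).2, (h'.matchedB r (by omega) b (hB0 b ▸ hb)).2, hB0]

theorem ShiftRel.Upay_eq (P : Pref A B) (hT : E.T = n + 1) (hn : 0 < n) (h : ShiftRel n x y)
    {a : A} (ha : x.mA 0 a = none) (s : ℕ) :
    Upay P E x (s + 1) a = Upay P (contEconomy E m 1) y s a := by
  rw [Upay_eq_payoff, Upay_eq_payoff, hT,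
    payoff_shift hn fun r hr => h.noneA r hr a ha]
  simp [contEconomy, hT]

theorem ShiftRel.Vpay_eq (P : Pref A B) (hT : E.T = n + 1) (hn : 0 < n) (h : ShiftRel n x y)
    {b : B} (hb : x.mB 0 b = none) (s : ℕ) :
    Vpay P E x (s + 1) b = Vpay P (contEconomy E m 1) y s b := by
  rw [Vpay_eq_payoff, Vpay_eq_payoff, hT,
    payoff_shift hn fun r hr => h.noneB r hr b hb]
  simp [contEconomy, hT]

theorem mA_zero_of_mem_availA {s : ℕ} {a : A} (ha : a ∈ availA E m (s + 1)) :
    m.mA 0 a = none :=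
  (Finset.mem_filter.mp ha).2 0 (by omega)

theorem mB_zero_of_mem_availB {s : ℕ} {b : B} (hb : b ∈ availB E m (s + 1)) :
    m.mB 0 b = none :=
  (Finset.mem_filter.mp hb).2 0 (by omega)

theorem ShiftRel.unmatchedThrough_iff (h : ShiftRel n x y) (hmx : agreeUpTo m x 1) {s : ℕ}
    (hs : s < n) {k : Agent A B} (hk : isAvail E m (s + 1) k) :
    unmatchedThrough x (s + 1) k ↔ unmatchedThrough y s k := by
  rcases k with a | b
  · have h0 : x.mA 0 a = none := (hmx 0 one_pos).1 a ▸ mA_zero_of_mem_availA hk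
    have := h.forall_mA_none (s := s + 1) (by omega) a
    simpa only [unmatchedThrough, h0, true_and, Nat.lt_succ_iff] using this
  · have h0 : x.mB 0 b = none := (hmx 0 one_pos).2 b ▸ mB_zero_of_mem_availB hk
    have := h.forall_mB_none (s := s + 1) (by omega) b
    simpa only [unmatchedThrough, h0, true_and, Nat.lt_succ_iff] using this

theorem ShiftRel.mem_MSet_iff {x' y' : PreMatching A B} (hE : E.DisjointArrivals)
    (hT : E.T = n + 1) (hx : IsMatching E x) (h : ShiftRel n x y) (h' : ShiftRel n x' y')
    (h0 : agreeUpTo x x' 1) {s : ℕ} (hs : s < n) {k : Agent A B}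
    (hk : isAvail E x (s + 1) k) :
    x' ∈ MSet E x (s + 1) k ↔ y' ∈ MSet (contEconomy E x 1) y s k := by
  refine and_congr ⟨fun hx' => ?_, fun hy' => h'.isMatching_left hE hT hx h0 hy'⟩
    (and_congr (h.agreeUpTo_iff h' h0 hs.le) (h'.unmatchedThrough_iff h0 hs hk))
  rw [contEconomy_congr h0]
  exact h'.isMatching_right hE hT hx'

end Shift

section Conjectures

variable {P : Pref A B} {DS : Economy A B → Set (PreMatching A B)} {E : Economy A B}
  {m x y : PreMatching A B} {n : ℕ}

theorem cvrIter_subset_MSet (t N : ℕ) (k : Agent A B) :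
    cvrIter P E DS t m N k ⊆ MSet E m t k := by
  cases N with
  | zero => exact subset_rfl
  | succ N => exact fun _ h => h.1

/-- Sets of matchings of an economy and of its continuation from the second period onward that
correspond to each other give rise to the same worst payoffs. -/
theorem ShiftRel.worst_payoff_eq (hE : E.DisjointArrivals) (hT : E.T = n + 1) (hn : 0 < n)
    (hx : IsMatching E x) {s : ℕ} {C C' : Agent A B → Set (PreMatching A B)}
    (hC : ∀ k, C k ⊆ MSet E x (s + 1) k)
    (hC' : ∀ k, C' k ⊆ MSet (contEconomy E x 1) y s k)
    (hCC' : ∀ k, isAvail E x (s + 1) k → ∀ x' y', ShiftRel n x' y' → agreeUpTo x x' 1 →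
      (x' ∈ C k ↔ y' ∈ C' k)) :
    (∀ a ∈ availA E x (s + 1), wA P E (s + 1) C a = wA P (contEconomy E x 1) s C' a) ∧
    (∀ b ∈ availB E x (s + 1), wB P E (s + 1) C b = wB P (contEconomy E x 1) s C' b) := by
  constructor
  · intro a ha
    unfold wA
    congr 1
    ext r
    constructor
    · rintro ⟨x', hx', rfl⟩
      obtain ⟨h1, h2, -⟩ := hC _ hx'
      have h0 := h2.mono (show 1 ≤ s + 1 by omega)
      have hs := h1.shiftRel_restrictM hT
      refine ⟨_, (hCC' (.inl a) ha _ _ hs h0).mp hx', ?_⟩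
      exact (hs.Upay_eq P hT hn ((h0 0 one_pos).1 a ▸ mA_zero_of_mem_availA ha) s).symm
    · rintro ⟨y', hy', rfl⟩
      obtain ⟨h1, -⟩ := hC' _ hy'
      have h0 := agreeUpTo_splice x y' 1
      have hs := hx.shiftRel_splice hE h1 hT
      refine ⟨_, (hCC' (.inl a) ha _ _ hs h0).mpr hy', ?_⟩
      exact hs.Upay_eq P hT hn ((h0 0 one_pos).1 a ▸ mA_zero_of_mem_availA ha) s
  · intro b hb
    unfold wB
    congr 1
    ext r
    constructor
    · rintro ⟨x', hx', rfl⟩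
      obtain ⟨h1, h2, -⟩ := hC _ hx'
      have h0 := h2.mono (show 1 ≤ s + 1 by omega)
      have hs := h1.shiftRel_restrictM hT
      refine ⟨_, (hCC' (.inr b) hb _ _ hs h0).mp hx', ?_⟩
      exact (hs.Vpay_eq P hT hn ((h0 0 one_pos).2 b ▸ mB_zero_of_mem_availB hb) s).symm
    · rintro ⟨y', hy', rfl⟩
      obtain ⟨h1, -⟩ := hC' _ hy'
      have h0 := agreeUpTo_splice x y' 1
      have hs := hx.shiftRel_splice hE h1 hT
      refine ⟨_, (hCC' (.inr b) hb _ _ hs h0).mpr hy', ?_⟩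
      exact hs.Vpay_eq P hT hn ((h0 0 one_pos).2 b ▸ mB_zero_of_mem_availB hb) s

theorem ShiftRel.mem_cvrIter_iff (hDS : IsCVRFamily P DS) (hE : E.DisjointArrivals)
    (hT : E.T = n + 1) (hx : IsMatching E x) (h : ShiftRel n x y) {s : ℕ} (hs : s < n) (N : ℕ) :
    ∀ k, isAvail E x (s + 1) k → ∀ x' y', ShiftRel n x' y' → agreeUpTo x x' 1 →
      (x' ∈ cvrIter P E DS (s + 1) x N k ↔ y' ∈ cvrIter P (contEconomy E x 1) DS s y N k) := by
  induction N with
  | zero => exact fun k hk x' y' h' h0 => h.mem_MSet_iff hE hT hx h' h0 hs hk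
  | succ N ih =>
    intro k hk x' y' h' h0
    have hM := h.mem_MSet_iff hE hT hx h' h0 hs hk
    obtain ⟨hwA, hwB⟩ := ShiftRel.worst_payoff_eq (P := P) hE hT (by omega) hx
      (cvrIter_subset_MSet (s + 1) N) (cvrIter_subset_MSet s N) ih
    rw [cvrIter, cvrIter, Set.mem_ofPred_eq, Set.mem_ofPred_eq, ← hM]
    refine and_congr_right fun hx' => and_congr ?_ ?_
    · have eA : ∀ a ∈ availA E x (s + 1), x'.mA (s + 1) a = y'.mA s a := fun a ha =>
        (h'.noneA s hs a ((h0 0 one_pos).1 a ▸ mA_zero_of_mem_availA ha)).symm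
      have eB : ∀ b ∈ availB E x (s + 1), x'.mB (s + 1) b = y'.mB s b := fun b hb =>
        (h'.noneB s hs b ((h0 0 one_pos).2 b ▸ mB_zero_of_mem_availB hb)).symm
      simp only [StableAmongMatched, h.availA_eq hE hT hx hs.le, h.availB_eq hE hT hx hs.le]
      refine and_congr (forall₂_congr fun a ha => ?_) (and_congr (forall₂_congr fun b hb => ?_)
        (forall₂_congr fun a ha => forall₂_congr fun b hb => ?_))
      · rw [eA a ha, hwA a ha]
      · rw [eB b hb, hwB b hb]
      · rw [eA a ha, eB b hb]
    · have hc : contEconomy (contEconomy E x 1) y' (s + 1) = contEconomy E x' (s + 1 + 1) := by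
        rw [contEconomy_congr h0]
        exact h'.contEconomy_eq hE hT hx'.1 (by omega)
      have ha := h'.agreeUpTo_restrictM (s := s + 1) (by omega)
      have hT' : (contEconomy E x' (s + 1 + 1)).T = n - (s + 1) := by
        simp only [contEconomy]; omega
      rw [hc]
      rw [← hT'] at ha
      exact ⟨hDS.mem_congr ha, hDS.mem_congr ha.symm⟩

theorem ShiftRel.mem_cvrConj_iff (hDS : IsCVRFamily P DS) (hE : E.DisjointArrivals)
    (hT : E.T = n + 1) (hx : IsMatching E x) (h : ShiftRel n x y) {s : ℕ} (hs : s < n)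
    {k : Agent A B} (hk : isAvail E x (s + 1) k) {x' y' : PreMatching A B}
    (h' : ShiftRel n x' y') (h0 : agreeUpTo x x' 1) :
    x' ∈ cvrConj P DS E (s + 1) x k ↔ y' ∈ cvrConj P DS (contEconomy E x 1) s y k := by
  simp only [cvrConj, Set.mem_iInter]
  exact forall_congr' fun N => h.mem_cvrIter_iff hDS hE hT hx hs N k hk x' y' h' h0

theorem cvrConj_subset_MSet (t : ℕ) (k : Agent A B) : cvrConj P DS E t m k ⊆ MSet E m t k :=
  fun _ h => Set.mem_iInter.mp h 0

/-- The conditions of a solution in the second and later periods are those of a solution of the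
continuation economy. -/
theorem ShiftRel.solution_conditions (hDS : IsCVRFamily P DS) (hE : E.DisjointArrivals)
    (hT : E.T = n + 1) (hx : IsMatching E x) (h : ShiftRel n x y)
    (hy : y ∈ SolSet P (contEconomy E x 1) (cvrConj P DS (contEconomy E x 1)))
    {s : ℕ} (hs : s < n) :
    (∀ a ∈ availA E x (s + 1), ∃ m' ∈ cvrConj P DS E (s + 1) x (Sum.inl a),
      Upay P E m' (s + 1) a ≤ Upay P E x (s + 1) a) ∧
    (∀ b ∈ availB E x (s + 1), ∃ m' ∈ cvrConj P DS E (s + 1) x (Sum.inr b),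
      Vpay P E m' (s + 1) b ≤ Vpay P E x (s + 1) b) ∧
    (∀ a ∈ availA E x (s + 1), ∀ b ∈ availB E x (s + 1),
      ¬(P.u a b > Upay P E x (s + 1) a ∧ P.v a b > Vpay P E x (s + 1) b)) := by
  have hn : 0 < n := by omega
  obtain ⟨h1, h2, h3⟩ := hy.2 s (by simp only [contEconomy]; omega)
  rw [h.availA_eq hE hT hx hs.le] at h1 h3
  rw [h.availB_eq hE hT hx hs.le] at h2 h3
  refine ⟨fun a ha => ?_, fun b hb => ?_, fun a ha b hb => ?_⟩
  · obtain ⟨y', hy', hle⟩ := h1 a ha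
    have h0 := agreeUpTo_splice x y' 1
    have h' := hx.shiftRel_splice hE (cvrConj_subset_MSet s _ hy').1 hT
    have hxa := mA_zero_of_mem_availA ha
    refine ⟨_, (h.mem_cvrConj_iff hDS hE hT hx hs (k := .inl a) ha h' h0).mpr hy', ?_⟩
    rwa [h.Upay_eq (m := x) P hT hn hxa, h'.Upay_eq (m := x) P hT hn ((h0 0 one_pos).1 a ▸ hxa)]
  · obtain ⟨y', hy', hle⟩ := h2 b hb
    have h0 := agreeUpTo_splice x y' 1
    have h' := hx.shiftRel_splice hE (cvrConj_subset_MSet s _ hy').1 hT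
    have hxb := mB_zero_of_mem_availB hb
    refine ⟨_, (h.mem_cvrConj_iff hDS hE hT hx hs (k := .inr b) hb h' h0).mpr hy', ?_⟩
    rwa [h.Vpay_eq (m := x) P hT hn hxb, h'.Vpay_eq (m := x) P hT hn ((h0 0 one_pos).2 b ▸ hxb)]
  · rw [h.Upay_eq (m := x) P hT hn (mA_zero_of_mem_availA ha),
      h.Vpay_eq (m := x) P hT hn (mB_zero_of_mem_availB hb)]
    exact h3 a ha b hb

theorem mem_availA_zero {a : A} : a ∈ availA E m 0 ↔ a ∈ E.arrA 0 := by
  simp [availA, arrAUpTo]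

theorem mem_availB_zero {b : B} : b ∈ availB E m 0 ↔ b ∈ E.arrB 0 := by
  simp [availB, arrBUpTo]

theorem IsCVRFamily.solSet_subset (hDS : IsCVRFamily P DS) (E : Economy A B) :
    SolSet P E (cvrConj P DS E) ⊆ DS E := by
  intro m hm
  rcases Nat.lt_trichotomy E.T 1 with hT | hT | hT
  · rw [hDS.1 E (by omega)]; trivial
  · rw [hDS.2.1 E hT]
    obtain ⟨h1, h2, h3⟩ := hm.2 0 (by omega)
    have hT' : E.T - 1 = 0 := by omega
    refine ⟨hm.1, fun a b hab => ?_, fun b a hab => ?_, fun a ha b hb => ?_⟩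
    · rw [hT'] at hab
      have ha : a ∈ availA E m 0 := Finset.mem_filter.mpr
        ⟨hm.1.2.1 0 a (by omega) (by simp [hab]), fun s hs => by omega⟩
      obtain ⟨m', hm', hle⟩ := h1 a ha
      rw [Upay_eq_payoff, Upay_eq_payoff,
        payoff_of_none (f := fun s => m'.mA s a)
          (hT' ▸ (cvrConj_subset_MSet 0 _ hm').2.2 0 le_rfl),
        payoff_of_some (f := fun s => m.mA s a) hab (hT' ▸ hab)] at hle
      exact hle
    · rw [hT'] at hab
      have hb : b ∈ availB E m 0 := Finset.mem_filter.mpr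
        ⟨hm.1.mem_arrBUpTo (by omega) (by simp [hab]), fun s hs => by omega⟩
      obtain ⟨m', hm', hle⟩ := h2 b hb
      rw [Vpay_eq_payoff, Vpay_eq_payoff,
        payoff_of_none (f := fun s => m'.mB s b)
          (hT' ▸ (cvrConj_subset_MSet 0 _ hm').2.2 0 le_rfl),
        payoff_of_some (f := fun s => m.mB s b) hab (hT' ▸ hab)] at hle
      exact hle
    · exact h3 a (mem_availA_zero.mpr ha) b (mem_availB_zero.mpr hb)
  · rw [hDS.2.2 E hT]; exact hm

/-- A matching whose first period is stable among those who match relative to every stage of the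
recursion, and whose continuation is a solution, is conjectured by everyone it leaves unmatched. -/
theorem mem_cvrConj_zero (hx : IsMatching E x)
    (hst : ∀ N, StableAmongMatched P E m 0 (cvrIter P E DS 0 m N) x)
    (hr : restrictM x 1 ∈ DS (contEconomy E x 1)) {k : Agent A B}
    (hk : unmatchedThrough x 0 k) : x ∈ cvrConj P DS E 0 m k := by
  have hM : x ∈ MSet E m 0 k := ⟨hx, fun s hs => by omega, hk⟩
  refine Set.mem_iInter.mpr fun N => ?_
  cases N with
  | zero => exact hM
  | succ N => exact ⟨hM, hst N, hr⟩

theorem finite_Upay_image (hT : 0 < E.T) {C : Set (PreMatching A B)}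
    (hC : ∀ m' ∈ C, IsMatching E m') (t : ℕ) (a : A) :
    ((fun m' => Upay P E m' t a) '' C).Finite := by
  refine (finite_payoff (P.dA a) (P.u a) E.T t (arrBUpTo E (E.T - 1))).subset ?_
  rintro _ ⟨m', hm', rfl⟩
  exact ⟨fun s => m'.mA s a, fun b hb => (hC m' hm').2.2.1 _ a b (by omega) hb, rfl⟩

theorem finite_Vpay_image (hT : 0 < E.T) {C : Set (PreMatching A B)}
    (hC : ∀ m' ∈ C, IsMatching E m') (t : ℕ) (b : B) :
    ((fun m' => Vpay P E m' t b) '' C).Finite := by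
  refine (finite_payoff (P.dB b) (P.v · b) E.T t (arrAUpTo E (E.T - 1))).subset ?_
  rintro _ ⟨m', hm', rfl⟩
  exact ⟨fun s => m'.mB s b, fun a ha => (hC m' hm').2.1 _ a (by omega)
    (by simp [((hC m' hm').1 _ a b (by omega)).mpr ha]), rfl⟩

end Conjectures

section Existence

variable {P : Pref A B} {DS : Economy A B → Set (PreMatching A B)} {E : Economy A B}

theorem isMatching_emptyM : IsMatching E emptyM := by
  simp [IsMatching, emptyM]

/-- There is a time-invariant matching of first-period arrivals that is stable given
arbitrary outside options. -/
theorem exists_isMatching_stable (P : Pref A B) (E : Economy A B) (WA : A → ℝ) (WB : B → ℝ) :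
    ∃ m : PreMatching A B, IsMatching E m ∧
      (∀ a b, m.mA 0 a = some b → WA a ≤ P.u a b ∧ WB b ≤ P.v a b) ∧
      (∀ a ∈ E.arrA 0, ∀ b ∈ E.arrB 0,
        ¬(P.u a b > indU P WA a (m.mA 0 a) ∧ P.v a b > indV P WB b (m.mB 0 b))) := by
  obtain ⟨f, hinj, hir, hq, hs⟩ := exists_stable_of_fintype
    (fun (a : E.arrA 0) (b : E.arrB 0) => P.u a b) (fun a b => P.v a b)
    (fun a => WA a) (fun b => WB b)
  let g : B → Option A := fun b => if h : b ∈ E.arrB 0 then (f ⟨b, h⟩).map Subtype.val else none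
  have hg : ∀ b a, g b = some a ↔ ∃ hb ha, f ⟨b, hb⟩ = some ⟨a, ha⟩ := by
    intro b a
    by_cases hb : b ∈ E.arrB 0
    · simp only [g, dif_pos hb, Option.map_eq_some_iff, Subtype.exists, exists_and_right,
        exists_eq_right, exists_true_left, hb]
    · simp [g, hb]
  have hginj : ∀ a b b', g b = some a → g b' = some a → b = b' := by
    intro a b b' h h'
    obtain ⟨hb, ha, h⟩ := (hg b a).mp h
    obtain ⟨hb', ha', h'⟩ := (hg b' a).mp h'
    exact congrArg Subtype.val (hinj _ _ _ h h')
  let e : A → Option B := fun a => if h : ∃ b, g b = some a then some h.choose else none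
  have he : ∀ a b, e a = some b ↔ g b = some a := by
    intro a b
    by_cases h : ∃ b, g b = some a
    · simp only [e, dif_pos h, Option.some.injEq]
      exact ⟨fun hb => hb ▸ h.choose_spec, fun hb => hginj a _ _ h.choose_spec hb⟩
    · simp only [e, dif_neg h, reduceCtorEq, false_iff]
      exact fun hb => h ⟨b, hb⟩
  have hA : ∀ a b, e a = some b → ∃ (hb : b ∈ E.arrB 0) (ha : a ∈ E.arrA 0),
      f ⟨b, hb⟩ = some ⟨a, ha⟩ := fun a b h => (hg b a).mp ((he a b).mp h)
  refine ⟨⟨fun _ => e, fun _ => g⟩, ⟨fun _ a b _ => he a b, fun t a _ ha => ?_,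
    fun t a b _ hab => ?_, fun _ _ _ _ _ _ => rfl, fun _ _ _ _ _ _ => rfl⟩, ?_, ?_⟩
  · obtain ⟨b, hab⟩ := Option.ne_none_iff_exists'.mp ha
    obtain ⟨-, ha, -⟩ := hA a b hab
    exact mem_arrAUpTo.mpr ⟨0, by omega, ha⟩
  · obtain ⟨hb, -⟩ := hA a b hab
    exact mem_arrBUpTo.mpr ⟨0, by omega, hb⟩
  · intro a b hab
    obtain ⟨hb, ha, h⟩ := hA a b hab
    exact hir _ _ h
  · rintro a ha b hb ⟨hu, hv⟩
    have hV : indV P WB b (g b) = (f ⟨b, hb⟩).elim (WB b) (fun x => P.v x b) := by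
      simp only [g, dif_pos hb]
      cases f ⟨b, hb⟩ <;> rfl
    refine absurd hv (not_lt.mpr ?_)
    simp only [hV]
    rcases h : e a with _ | b'
    · refine hs ⟨a, ha⟩ ⟨b, hb⟩ (fun b' hb' => ?_) (by simpa [h, indU] using hu)
      have := (he a b').mpr ((hg b' a).mpr ⟨b'.2, ha, hb'⟩)
      simp [h] at this
    · obtain ⟨hb', ha', hf⟩ := hA a b' h
      exact hq ⟨a, ha⟩ ⟨b, hb⟩ ⟨b', hb'⟩ hf (by simpa [h, indU] using hu)

/-- A matching followed by a solution of its continuation economy. -/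
theorem exists_continuation (hDS : IsCVRFamily P DS) (hE : E.DisjointArrivals) {n : ℕ}
    (hT : E.T = n + 1) {m : PreMatching A B} (hm : IsMatching E m)
    (hne : (SolSet P (contEconomy E m 1) (cvrConj P DS (contEconomy E m 1))).Nonempty) :
    ∃ x, IsMatching E x ∧ agreeUpTo m x 1 ∧ restrictM x 1 ∈ DS (contEconomy E x 1) ∧
      ∃ y ∈ SolSet P (contEconomy E x 1) (cvrConj P DS (contEconomy E x 1)),
        ShiftRel n x y := by
  obtain ⟨y, hy⟩ := hne
  have h0 := agreeUpTo_splice m y 1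
  have h := hm.shiftRel_splice hE hy.1 hT
  have hx := h.isMatching_left hE hT hm h0 hy.1
  have hy' := hy
  rw [contEconomy_congr h0] at hy'
  refine ⟨_, hx, h0, hDS.mem_congr ?_ (hDS.solSet_subset _ hy'), y, hy', h⟩
  have ha := (h.agreeUpTo_iff (s := n) (hx.shiftRel_restrictM hT)
    (fun _ _ => ⟨fun _ => rfl, fun _ => rfl⟩) le_rfl).mp
    (fun _ _ => ⟨fun _ => rfl, fun _ => rfl⟩)
  exact ha.mono (by simp only [contEconomy]; omega)

theorem IsCVRFamily.solSet_nonempty (hDS : IsCVRFamily P DS) (n : ℕ) :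
    ∀ E : Economy A B, E.T = n → E.DisjointArrivals →
      (SolSet P E (cvrConj P DS E)).Nonempty := by
  induction n with
  | zero => exact fun E hT _ => ⟨emptyM, isMatching_emptyM, fun t ht => by omega⟩
  | succ n ih =>
    intro E hT hE
    have hT0 : 0 < E.T := by omega
    have hcont : ∀ m,
        (SolSet P (contEconomy E m 1) (cvrConj P DS (contEconomy E m 1))).Nonempty :=
      fun m => ih _ (by simp only [contEconomy]; omega) (hE.contEconomy_one m)
    set C := cvrConj P DS E 0 emptyM with hC
    have hCM : ∀ k, ∀ m' ∈ C k, IsMatching E m' := fun k m' hm' => (cvrConj_subset_MSet 0 k hm').1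
    have hCN : ∀ N k, C k ⊆ cvrIter P E DS 0 emptyM N k := fun N k => Set.iInter_subset _ N
    have hCne : ∀ k, (C k).Nonempty := by
      obtain ⟨z, hz, hz0, hzr, -⟩ :=
        exists_continuation hDS hE hT isMatching_emptyM (hcont _)
      have hzA : ∀ a, z.mA 0 a = none := fun a => ((hz0 0 one_pos).1 a).symm
      have hzB : ∀ b, z.mB 0 b = none := fun b => ((hz0 0 one_pos).2 b).symm
      refine fun k => ⟨z, mem_cvrConj_zero hz (fun N => ?_) hzr ?_⟩
      · simp [StableAmongMatched, hzA, hzB]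
      · rcases k with a | b
        · exact fun s hs => by rw [Nat.le_zero.mp hs]; exact hzA a
        · exact fun s hs => by rw [Nat.le_zero.mp hs]; exact hzB b
    have hwA : ∀ N a, wA P E 0 (cvrIter P E DS 0 emptyM N) a ≤ wA P E 0 C a := fun N a =>
      csInf_le_csInf (finite_Upay_image hT0
        (fun m' hm' => (cvrIter_subset_MSet 0 N _ hm').1) 0 a).bddBelow
        ((hCne _).image _) (Set.image_mono (hCN N _))
    have hwB : ∀ N b, wB P E 0 (cvrIter P E DS 0 emptyM N) b ≤ wB P E 0 C b := fun N b =>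
      csInf_le_csInf (finite_Vpay_image hT0
        (fun m' hm' => (cvrIter_subset_MSet 0 N _ hm').1) 0 b).bddBelow
        ((hCne _).image _) (Set.image_mono (hCN N _))
    obtain ⟨m, hm, hir, hst⟩ := exists_isMatching_stable P E (wA P E 0 C) (wB P E 0 C)
    obtain ⟨x, hx, hx0, hxr, y, hy, h⟩ := exists_continuation hDS hE hT hm (hcont m)
    simp only [(hx0 0 one_pos).1, (hx0 0 one_pos).2] at hir hst
    have hAB : ∀ a b, x.mA 0 a = some b ↔ x.mB 0 b = some a := fun a b => hx.1 0 a b hT0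
    have hirB : ∀ b a, x.mB 0 b = some a → wB P E 0 C b ≤ P.v a b :=
      fun b a hb => (hir a b ((hAB a b).mpr hb)).2
    have hxC : ∀ k, unmatchedThrough x 0 k → x ∈ C k := by
      refine fun k => mem_cvrConj_zero hx (fun N => ⟨fun a _ b hab => ?_, fun b _ a hba => ?_,
        fun a ha b hb b' a' hab hba => ?_⟩) hxr
      · exact (hwA N a).trans (hir a b hab).1
      · exact (hwB N b).trans (hirB b a hba)
      · have := hst a (mem_availA_zero.mp ha) b (mem_availB_zero.mp hb)
        simpa only [hab, hba, indU, indV] using this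
    have hxA : ∀ a, x.mA 0 a = none → x ∈ C (.inl a) :=
      fun a ha => hxC _ fun s hs => by rw [Nat.le_zero.mp hs]; exact ha
    have hxB : ∀ b, x.mB 0 b = none → x ∈ C (.inr b) :=
      fun b hb => hxC _ fun s hs => by rw [Nat.le_zero.mp hs]; exact hb
    have hU : ∀ a b, x.mA 0 a = some b → Upay P E x 0 a = P.u a b := fun a b hab =>
      payoff_of_some (w := P.u a) (f := fun s => x.mA s a) hab
        ((hx.2.2.2.1 0 (E.T - 1) a (by omega) (by omega) (by simp [hab])).trans hab)
    have hV : ∀ b a, x.mB 0 b = some a → Vpay P E x 0 b = P.v a b := fun b a hba =>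
      payoff_of_some (w := (P.v · b)) (f := fun s => x.mB s b) hba
        ((hx.2.2.2.2 0 (E.T - 1) b (by omega) (by omega) (by simp [hba])).trans hba)
    have hfA : ∀ a, ((fun m' => Upay P E m' 0 a) '' C (.inl a)).Finite :=
      fun a => finite_Upay_image hT0 (hCM _) 0 a
    have hfB : ∀ b, ((fun m' => Vpay P E m' 0 b) '' C (.inr b)).Finite :=
      fun b => finite_Vpay_image hT0 (hCM _) 0 b
    refine ⟨x, hx, fun t ht => ?_⟩
    obtain _ | s := t
    · rw [cvrConj_congr (m' := emptyM) (fun s hs => by omega), ← hC]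
      refine ⟨fun a _ => ?_, fun b _ => ?_, fun a ha b hb ⟨hu, hv⟩ => ?_⟩
      · rcases hab : x.mA 0 a with _ | b
        · exact ⟨x, hxA a hab, le_rfl⟩
        · obtain ⟨m', hm', he⟩ := ((hCne (.inl a)).image _).csInf_mem (hfA a)
          exact ⟨m', hm', by rw [hU a b hab]; exact he.trans_le (hir a b hab).1⟩
      · rcases hba : x.mB 0 b with _ | a
        · exact ⟨x, hxB b hba, le_rfl⟩
        · obtain ⟨m', hm', he⟩ := ((hCne (.inr b)).image _).csInf_mem (hfB b)
          exact ⟨m', hm', by rw [hV b a hba]; exact he.trans_le (hirB b a hba)⟩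
      · refine hst a (mem_availA_zero.mp ha) b (mem_availB_zero.mp hb)
          ⟨lt_of_le_of_lt ?_ hu, lt_of_le_of_lt ?_ hv⟩
        · rcases hab : x.mA 0 a with _ | b'
          · exact csInf_le (hfA a).bddBelow ⟨x, hxA a hab, rfl⟩
          · exact (hU a b' hab).ge
        · rcases hba : x.mB 0 b with _ | a'
          · exact csInf_le (hfB b).bddBelow ⟨x, hxB b hba, rfl⟩
          · exact (hV b a' hba).ge
    · exact h.solution_conditions hDS hE hT hx hy (by omega)

end Existence

theorem statement10
    (A B : Type) [DecidableEq A] [DecidableEq B]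
    (P : Pref A B) (hP : P.Valid)
    (DS : Economy A B → Set (PreMatching A B)) (hDS : IsCVRFamily P DS)
    (E : Economy A B) (hE : E.Valid) :
    (DS E).Nonempty := by
  exact (hDS.solSet_nonempty E.T E rfl ⟨hE.2.1, hE.2.2.1⟩).mono (hDS.solSet_subset E)

end

end DynMatch
end

section
/- For every period t, every matching history m^{t−1}, and every agent k available in period t, the CVR conjectures are contained in the dynamic-stability conjectures, φ_{D̂S,t}(m^{t−1},k) ⊆ φ_{DS,t}(m^{t−1},k); consequently, for every length-T economy E^T, every CVR-dynamically stable matching is dynamically stable: D̂S_T(E^T) ⊆ DS_T(E^T). -/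
/-!
A framework for two-sided, one-to-one, irreversible dynamic matching markets
with conjectures, following Doval's "A framework for (dynamic) stability".

Periods are indexed `0, …, T-1` (the paper's periods `1, …, T`).
-/

namespace DynMatch

open Classical

noncomputable section

variable {A B : Type} [DecidableEq A] [DecidableEq B]

/-- The delay until a first match, for an agent with path of partners `f` who is single
through period `t` and matched in the last period, exceeds by one the delay counted from
period `t + 1`. -/
lemma matchDelay_eq_add_one {C : Type} (f : ℕ → Option C) {t T : ℕ} (ht : t < T)
    (hf : ∀ s, s ≤ t → f s = none) (hT : f (T - 1) ≠ none) :
    min (sInf {s | t ≤ s ∧ f s ≠ none}) T - t =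
      min (sInf {s | 0 ≤ s ∧ f (t + 1 + s) ≠ none}) (T - (t + 1)) - 0 + 1 := by
  have htT : t < T - 1 := by
    by_contra h
    exact hT (hf _ (by omega))
  have hne : {s | t ≤ s ∧ f s ≠ none}.Nonempty := ⟨T - 1, by omega, hT⟩
  have hne' : {s | 0 ≤ s ∧ f (t + 1 + s) ≠ none}.Nonempty :=
    ⟨T - 1 - (t + 1), by omega, by rwa [show t + 1 + (T - 1 - (t + 1)) = T - 1 by omega]⟩
  obtain ⟨-, h₂⟩ := Nat.sInf_mem hne
  obtain ⟨-, h₂'⟩ := Nat.sInf_mem hne'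
  have hlt : t < sInf {s | t ≤ s ∧ f s ≠ none} := by
    by_contra h
    exact h₂ (hf _ (by omega))
  have hle : sInf {s | t ≤ s ∧ f s ≠ none} ≤
      t + 1 + sInf {s | 0 ≤ s ∧ f (t + 1 + s) ≠ none} :=
    Nat.sInf_le ⟨by omega, h₂'⟩
  have hle' : sInf {s | 0 ≤ s ∧ f (t + 1 + s) ≠ none} ≤
      sInf {s | t ≤ s ∧ f s ≠ none} - (t + 1) := by
    refine Nat.sInf_le ⟨by omega, ?_⟩
    rwa [show t + 1 + (sInf {s | t ≤ s ∧ f s ≠ none} - (t + 1)) =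
      sInf {s | t ≤ s ∧ f s ≠ none} by omega]
  omega

/-- The payoff of a side-`A` agent who is single through period `t` is its discounted payoff
in the continuation economy. -/
lemma Upay_eq_mul_Upay_contEconomy (P : Pref A B) (E : Economy A B) (m : PreMatching A B)
    {t : ℕ} (ht : t + 1 < E.T) (a : A) (h : unmatchedThrough m t (Sum.inl a)) :
    Upay P E m t a =
      P.dA a * Upay P (contEconomy E m (t + 1)) (restrictM m (t + 1)) 0 a := by
  have h' : ∀ s, s ≤ t → m.mA s a = none := h
  have hr : ∀ s, (restrictM m (t + 1)).mA s a = m.mA (t + 1 + s) a := fun s =>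
    if_pos fun s' hs' => h' s' (by omega)
  have hlast : t + 1 + ((contEconomy E m (t + 1)).T - 1) = E.T - 1 := by
    simp only [contEconomy]
    omega
  rcases hm : m.mA (E.T - 1) a with _ | b
  · simp [Upay, hr, hlast, hm]
  · have key := matchDelay_eq_add_one (fun s => m.mA s a) (by omega : t < E.T) h' (by simp [hm])
    simp only [Upay, hr, hlast, hm, matchTimeA]
    rw [key, pow_succ]
    simp only [contEconomy]
    ring

/-- The payoff of a side-`B` agent who is single through period `t` is its discounted payoff
in the continuation economy. -/
lemma Vpay_eq_mul_Vpay_contEconomy (P : Pref A B) (E : Economy A B) (m : PreMatching A B)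
    {t : ℕ} (ht : t + 1 < E.T) (b : B) (h : unmatchedThrough m t (Sum.inr b)) :
    Vpay P E m t b =
      P.dB b * Vpay P (contEconomy E m (t + 1)) (restrictM m (t + 1)) 0 b := by
  have h' : ∀ s, s ≤ t → m.mB s b = none := h
  have hr : ∀ s, (restrictM m (t + 1)).mB s b = m.mB (t + 1 + s) b := fun s =>
    if_pos fun s' hs' => h' s' (by omega)
  have hlast : t + 1 + ((contEconomy E m (t + 1)).T - 1) = E.T - 1 := by
    simp only [contEconomy]
    omega
  rcases hm : m.mB (E.T - 1) b with _ | a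
  · simp [Vpay, hr, hlast, hm]
  · have key := matchDelay_eq_add_one (fun s => m.mB s b) (by omega : t < E.T) h' (by simp [hm])
    simp only [Vpay, hr, hlast, hm, matchTimeB]
    rw [key, pow_succ]
    simp only [contEconomy]
    ring

/-- If every continuation in `S` is individually rational for available side-`A` agents,
then so is remaining single for one period and continuing with an element of `S`. -/
lemma Upay_nonneg_of_continuation {P : Pref A B} (hP : P.Valid)
    {S : Economy A B → Set (PreMatching A B)} {E : Economy A B} {m mbar : PreMatching A B}
    {t : ℕ} (ht : t < E.T) {a : A} (ha : a ∈ availA E m t)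
    (hS : ∀ E' : Economy A B, 0 < E'.T → E'.T < E.T →
      ∀ m' ∈ S E', ∀ a ∈ E'.arrA 0, 0 ≤ Upay P E' m' 0 a)
    (hm : mbar ∈ MSet E m t (Sum.inl a))
    (hc : restrictM mbar (t + 1) ∈ S (contEconomy E mbar (t + 1))) :
    0 ≤ Upay P E mbar t a := by
  have hun : ∀ s, s ≤ t → mbar.mA s a = none := hm.2.2
  rcases Nat.lt_or_ge (t + 1) E.T with htT | htT
  · rw [Upay_eq_mul_Upay_contEconomy P E mbar htT a hun]
    refine mul_nonneg (hP.1 a).1 (hS _ ?_ ?_ _ hc a ?_)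
    · simp only [contEconomy]
      omega
    · simp only [contEconomy]
      omega
    · have hup : a ∈ arrAUpTo E t := (Finset.mem_filter.1 ha).1
      simp only [contEconomy, if_pos, availA, Finset.mem_filter]
      refine ⟨?_, fun s hs => hun s (by omega)⟩
      simp only [arrAUpTo, Finset.mem_biUnion, Finset.mem_range] at hup ⊢
      obtain ⟨s, hs, has⟩ := hup
      exact ⟨s, by omega, has⟩
  · have h0 : mbar.mA (E.T - 1) a = none := hun _ (by omega)
    simp [Upay, h0]

/-- CVR-dynamically stable matchings are individually rational for the side-`A` agents
available in the first period. -/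
lemma IsCVRFamily.Upay_nonneg {P : Pref A B} (hP : P.Valid)
    {S : Economy A B → Set (PreMatching A B)} (h : IsCVRFamily P S) (E : Economy A B)
    (hT : 0 < E.T) {m : PreMatching A B} (hm : m ∈ S E) {a : A} (ha : a ∈ E.arrA 0) :
    0 ≤ Upay P E m 0 a := by
  induction hn : E.T using Nat.strong_induction_on generalizing E m a with
  | _ n ih =>
  rcases Nat.lt_or_ge E.T 2 with h2 | h2
  · have h1 : E.T = 1 := by omega
    rw [h.2.1 E h1] at hm
    rcases hb : m.mA (E.T - 1) a with _ | b
    · simp [Upay, hb]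
    · simpa [Upay, hb] using mul_nonneg (pow_nonneg (hP.1 a).1 _) (hm.2.1 a b hb)
  · rw [h.2.2 E h2] at hm
    have hav : a ∈ availA E m 0 := by simpa [availA, arrAUpTo] using ha
    obtain ⟨m', hm', hle⟩ := (hm.2 0 hT).1 a hav
    have hm1 := Set.mem_iInter.1 hm' 1
    refine le_trans (Upay_nonneg_of_continuation hP hT hav ?_ hm1.1 hm1.2.2) hle
    intro E' hpos hlt m'' hm'' a' ha'
    exact ih E'.T (by omega) E' hpos hm'' ha' rfl

/-- The worst payoff of a side-`A` agent after one round of the recursion defining the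
CVR conjectures is nonnegative. -/
lemma IsCVRFamily.wA_cvrIter_nonneg {P : Pref A B} (hP : P.Valid)
    {S : Economy A B → Set (PreMatching A B)} (h : IsCVRFamily P S) {E : Economy A B}
    {m : PreMatching A B} {t : ℕ} (ht : t < E.T) {a : A} (ha : a ∈ availA E m t) :
    0 ≤ wA P E t (cvrIter P E S t m 1) a := by
  refine Real.sInf_nonneg ?_
  rintro _ ⟨mbar, hmbar, rfl⟩
  exact Upay_nonneg_of_continuation hP ht ha
    (fun E' hpos _ m' hm' a' ha' => h.Upay_nonneg hP E' hpos hm' ha') hmbar.1 hmbar.2.2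

/-- If every continuation in `S` is individually rational for available side-`B` agents,
then so is remaining single for one period and continuing with an element of `S`. -/
lemma Vpay_nonneg_of_continuation {P : Pref A B} (hP : P.Valid)
    {S : Economy A B → Set (PreMatching A B)} {E : Economy A B} {m mbar : PreMatching A B}
    {t : ℕ} (ht : t < E.T) {b : B} (hb : b ∈ availB E m t)
    (hS : ∀ E' : Economy A B, 0 < E'.T → E'.T < E.T →
      ∀ m' ∈ S E', ∀ b ∈ E'.arrB 0, 0 ≤ Vpay P E' m' 0 b)
    (hm : mbar ∈ MSet E m t (Sum.inr b))
    (hc : restrictM mbar (t + 1) ∈ S (contEconomy E mbar (t + 1))) :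
    0 ≤ Vpay P E mbar t b := by
  have hun : ∀ s, s ≤ t → mbar.mB s b = none := hm.2.2
  rcases Nat.lt_or_ge (t + 1) E.T with htT | htT
  · rw [Vpay_eq_mul_Vpay_contEconomy P E mbar htT b hun]
    refine mul_nonneg (hP.2 b).1 (hS _ ?_ ?_ _ hc b ?_)
    · simp only [contEconomy]
      omega
    · simp only [contEconomy]
      omega
    · have hup : b ∈ arrBUpTo E t := (Finset.mem_filter.1 hb).1
      simp only [contEconomy, if_pos, availB, Finset.mem_filter]
      refine ⟨?_, fun s hs => hun s (by omega)⟩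
      simp only [arrBUpTo, Finset.mem_biUnion, Finset.mem_range] at hup ⊢
      obtain ⟨s, hs, hbs⟩ := hup
      exact ⟨s, by omega, hbs⟩
  · have h0 : mbar.mB (E.T - 1) b = none := hun _ (by omega)
    simp [Vpay, h0]

/-- CVR-dynamically stable matchings are individually rational for the side-`B` agents
available in the first period. -/
lemma IsCVRFamily.Vpay_nonneg {P : Pref A B} (hP : P.Valid)
    {S : Economy A B → Set (PreMatching A B)} (h : IsCVRFamily P S) (E : Economy A B)
    (hT : 0 < E.T) {m : PreMatching A B} (hm : m ∈ S E) {b : B} (hb : b ∈ E.arrB 0) :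
    0 ≤ Vpay P E m 0 b := by
  induction hn : E.T using Nat.strong_induction_on generalizing E m b with
  | _ n ih =>
  rcases Nat.lt_or_ge E.T 2 with h2 | h2
  · have h1 : E.T = 1 := by omega
    rw [h.2.1 E h1] at hm
    rcases ha : m.mB (E.T - 1) b with _ | a
    · simp [Vpay, ha]
    · simpa [Vpay, ha] using mul_nonneg (pow_nonneg (hP.2 b).1 _) (hm.2.2.1 b a ha)
  · rw [h.2.2 E h2] at hm
    have hav : b ∈ availB E m 0 := by simpa [availB, arrBUpTo] using hb
    obtain ⟨m', hm', hle⟩ := (hm.2 0 hT).2.1 b hav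
    have hm1 := Set.mem_iInter.1 hm' 1
    refine le_trans (Vpay_nonneg_of_continuation hP hT hav ?_ hm1.1 hm1.2.2) hle
    intro E' hpos hlt m'' hm'' b' hb'
    exact ih E'.T (by omega) E' hpos hm'' hb' rfl

/-- The worst payoff of a side-`B` agent after one round of the recursion defining the
CVR conjectures is nonnegative. -/
lemma IsCVRFamily.wB_cvrIter_nonneg {P : Pref A B} (hP : P.Valid)
    {S : Economy A B → Set (PreMatching A B)} (h : IsCVRFamily P S) {E : Economy A B}
    {m : PreMatching A B} {t : ℕ} (ht : t < E.T) {b : B} (hb : b ∈ availB E m t) :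
    0 ≤ wB P E t (cvrIter P E S t m 1) b := by
  refine Real.sInf_nonneg ?_
  rintro _ ⟨mbar, hmbar, rfl⟩
  exact Vpay_nonneg_of_continuation hP ht hb
    (fun E' hpos _ m' hm' b' hb' => h.Vpay_nonneg hP E' hpos hm' hb') hmbar.1 hmbar.2.2

/-- The CVR conjectures are contained in the dynamic-stability conjectures as soon as
continuation solutions are. -/
lemma IsCVRFamily.cvrConj_subset_dsConj {P : Pref A B} (hP : P.Valid)
    {S S' : Economy A B → Set (PreMatching A B)} (h : IsCVRFamily P S) {E : Economy A B}
    (hS : ∀ E' : Economy A B, E'.T < E.T → S E' ⊆ S' E') {t : ℕ} (ht : t < E.T)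
    (m : PreMatching A B) (k : Agent A B) :
    cvrConj P S E t m k ⊆ dsConj P S' E t m k := by
  intro mbar hmbar
  obtain ⟨hM, ⟨hA, hB, hblock⟩, hc⟩ := Set.mem_iInter.1 hmbar 2
  refine ⟨hM, fun a ha b hab => ?_, fun b hb a hba => ?_, hblock, hS _ ?_ hc⟩
  · exact (h.wA_cvrIter_nonneg hP ht ha).trans (hA a ha b hab)
  · exact (h.wB_cvrIter_nonneg hP ht hb).trans (hB b hb a hba)
  · simp only [contEconomy]
    omega

/-- Solutions are monotone in the conjectures. -/
lemma IsSolution.mono {P : Pref A B} {E : Economy A B} {φ ψ : ConjFam A B}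
    {m : PreMatching A B} (hφ : ∀ t, t < E.T → ∀ k, φ t m k ⊆ ψ t m k)
    (h : IsSolution P E φ m) : IsSolution P E ψ m := by
  refine ⟨h.1, fun t ht => ⟨fun a ha => ?_, fun b hb => ?_, (h.2 t ht).2.2⟩⟩
  · obtain ⟨m', hm', hle⟩ := (h.2 t ht).1 a ha
    exact ⟨m', hφ t ht _ hm', hle⟩
  · obtain ⟨m', hm', hle⟩ := (h.2 t ht).2.1 b hb
    exact ⟨m', hφ t ht _ hm', hle⟩

/-- CVR-dynamically stable matchings are dynamically stable. -/
lemma IsCVRFamily.subset_of_isDSFamily {P : Pref A B} (hP : P.Valid)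
    {S S' : Economy A B → Set (PreMatching A B)} (h : IsCVRFamily P S)
    (h' : IsDSFamily P S') (E : Economy A B) : S E ⊆ S' E := by
  induction hn : E.T using Nat.strong_induction_on generalizing E with
  | _ n ih =>
  obtain h0 | h1 | h2 : E.T = 0 ∨ E.T = 1 ∨ 2 ≤ E.T := by omega
  · rw [h.1 E h0, h'.1 E h0]
  · rw [h.2.1 E h1, h'.2.1 E h1]
  · rw [h.2.2 E h2, h'.2.2 E h2]
    exact fun m hm => IsSolution.mono (fun t ht k => h.cvrConj_subset_dsConj hP
      (fun E' hE' => ih E'.T (by omega) E' rfl) ht m k) hm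

/-- the CVR conjectures are contained in the dynamic-stability
conjectures, for every period, history and available agent; consequently every
CVR-dynamically stable matching is dynamically stable. -/
theorem statement13
    (A B : Type) [DecidableEq A] [DecidableEq B]
    (P : Pref A B) (hP : P.Valid)
    (DShat DSol : Economy A B → Set (PreMatching A B))
    (h1 : IsCVRFamily P DShat) (h2 : IsDSFamily P DSol)
    (E : Economy A B) (hE : E.Valid) :
    (∀ t, t < E.T → ∀ m : PreMatching A B, IsMatching E m → ∀ k : Agent A B,
        isAvail E m t k → cvrConj P DShat E t m k ⊆ dsConj P DSol E t m k) ∧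
    DShat E ⊆ DSol E := by
  exact ⟨fun t ht m _ k _ => h1.cvrConj_subset_dsConj hP
    (fun E' _ => h1.subset_of_isDSFamily hP h2 E') ht m k, h1.subset_of_isDSFamily hP h2 E⟩

end

end DynMatch
end
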